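/- arXiv:math/0305126 — 7 statements merged into one kernel-verified Lean document; each statement's English description precedes it below -/
import Mathlib

section
/- Let μ be an infinitely divisible probability measure on ℝ that is concentrated on the nonnegative integers (μ assigns full mass to the set of nonnegative integers, viewed as real numbers). Then μ({0}) > 0 if and only if for every integer n ≥ 1 and every probability measure ν on ℝ whose n-fold convolution equals μ, the topological support of ν equals the topological support of μ. -/
open MeasureTheory

/-- Convolution of two measures on ℝ (law of the sum of independent random variables). -/
noncomputable def mconv (μ ν : Measure ℝ) : Measure ℝ :=
  (μ.prod ν).map (fun p => p.1 + p.2)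

/-- n-fold convolution of ν (with the 0-fold convolution being the Dirac mass at 0). -/
noncomputable def nmconv (ν : Measure ℝ) : ℕ → Measure ℝ
  | 0 => Measure.dirac 0
  | n + 1 => mconv ν (nmconv ν n)

/-- The topological support of a measure on ℝ: the set of points all of whose open
neighbourhoods have positive measure (the smallest closed set of full measure). -/
def msupport (μ : Measure ℝ) : Set ℝ :=
  {x : ℝ | ∀ U : Set ℝ, IsOpen U → x ∈ U → 0 < μ U}

open Filter

lemma msupport_eq_support (μ : Measure ℝ) : msupport μ = μ.support := by
  rw [Measure.support_eq_forall_isOpen]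
  ext x
  exact ⟨fun h U hx hU => h U hU hx, fun h U hU hx => h U hx hU⟩

instance isProbabilityMeasure_mconv (μ ν : Measure ℝ) [IsProbabilityMeasure μ]
    [IsProbabilityMeasure ν] : IsProbabilityMeasure (mconv μ ν) :=
  Measure.isProbabilityMeasure_map (by fun_prop)

instance isProbabilityMeasure_nmconv (ν : Measure ℝ) [IsProbabilityMeasure ν] (n : ℕ) :
    IsProbabilityMeasure (nmconv ν n) := by
  induction n with
  | zero => exact inferInstanceAs (IsProbabilityMeasure (Measure.dirac (0 : ℝ)))
  | succ n ih => exact inferInstanceAs (IsProbabilityMeasure (mconv ν (nmconv ν n)))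

lemma mul_le_mconv (μ ν : Measure ℝ) [IsProbabilityMeasure μ] [IsProbabilityMeasure ν]
    {A B C : Set ℝ} (hC : MeasurableSet C) (h : ∀ x ∈ A, ∀ y ∈ B, x + y ∈ C) :
    μ A * ν B ≤ mconv μ ν C := by
  rw [mconv, Measure.map_apply (by fun_prop) hC, ← Measure.prod_prod]
  exact measure_mono fun p hp => h _ hp.1 _ hp.2

lemma pow_le_nmconv (ν : Measure ℝ) [IsProbabilityMeasure ν] {A B : Set ℝ}
    (hB : MeasurableSet B) (h0 : (0 : ℝ) ∈ B) (h : ∀ x ∈ A, ∀ y ∈ B, x + y ∈ B) (n : ℕ) :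
    ν A ^ n ≤ nmconv ν n B := by
  induction n with
  | zero => simp [nmconv, hB, h0]
  | succ n ih =>
    rw [pow_succ']
    exact (mul_le_mul_right ih _).trans (mul_le_mconv _ _ hB h)

lemma ae_mconv {μ ν : Measure ℝ} [IsProbabilityMeasure μ] [IsProbabilityMeasure ν]
    {A B C : Set ℝ} (hA : ∀ᵐ x ∂μ, x ∈ A) (hB : ∀ᵐ x ∂ν, x ∈ B) (hC : MeasurableSet C)
    (h : ∀ x ∈ A, ∀ y ∈ B, x + y ∈ C) : ∀ᵐ x ∂mconv μ ν, x ∈ C := by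
  refine (ae_map_iff (by fun_prop) hC).2 ?_
  filter_upwards [Measure.quasiMeasurePreserving_fst.ae hA,
    Measure.quasiMeasurePreserving_snd.ae hB] with p h1 h2 using h _ h1 _ h2

lemma ae_nmconv {ν : Measure ℝ} [IsProbabilityMeasure ν] {A B : Set ℝ}
    (hA : ∀ᵐ x ∂ν, x ∈ A) (hB : MeasurableSet B) (h0 : (0 : ℝ) ∈ B)
    (h : ∀ x ∈ A, ∀ y ∈ B, x + y ∈ B) (n : ℕ) : ∀ᵐ x ∂nmconv ν n, x ∈ B := by
  induction n with
  | zero => exact (ae_dirac_iff hB).2 h0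
  | succ n ih => exact ae_mconv hA ih hB h

/-- The nonnegative integers, as a set of reals. -/
abbrev natSet : Set ℝ := Set.range (fun n : ℕ => (n : ℝ))

lemma measurableSet_natSet : MeasurableSet natSet := (Set.countable_range _).measurableSet

lemma natSet_add {x y : ℝ} (hx : x ∈ natSet) (hy : y ∈ natSet) : x + y ∈ natSet := by
  obtain ⟨a, rfl⟩ := hx
  obtain ⟨b, rfl⟩ := hy
  exact ⟨a + b, by push_cast; rfl⟩

/-- A convolution root of a nonnegative law is nonnegative. -/
lemma ae_nonneg_of_nmconv {ν : Measure ℝ} [IsProbabilityMeasure ν] {n : ℕ}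
    (h : ∀ᵐ x ∂nmconv ν (n + 1), 0 ≤ x) : ∀ᵐ x ∂ν, 0 ≤ x := by
  have h1 : ν (Set.Iio 0) * ν (Set.Iio 0) ^ n ≤ nmconv ν (n + 1) (Set.Iio 0) :=
    (mul_le_mul_right (pow_le_nmconv ν measurableSet_Iic (Set.self_mem_Iic)
      (fun x hx y hy => by simp only [Set.mem_Iio, Set.mem_Iic] at *; linarith) n) _).trans
      (mul_le_mconv ν _ measurableSet_Iio
        (fun x hx y hy => by simp only [Set.mem_Iio, Set.mem_Iic] at *; linarith))
  have h2 : nmconv ν (n + 1) (Set.Iio 0) = 0 := by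
    simpa [ae_iff, not_le, Set.Iio] using h
  rw [h2, ← pow_succ', nonpos_iff_eq_zero, pow_eq_zero_iff (Nat.succ_ne_zero n)] at h1
  simpa [ae_iff, not_le, Set.Iio] using h1

lemma root_singleton_zero_pos {ν : Measure ℝ} [IsProbabilityMeasure ν] {n : ℕ}
    (h : ∀ᵐ x ∂nmconv ν (n + 1), 0 ≤ x) (h0 : 0 < nmconv ν (n + 1) {0}) : 0 < ν {0} := by
  by_contra hν
  have hnonneg := ae_nonneg_of_nmconv h
  have hne : ∀ᵐ x ∂ν, x ≠ 0 := by simpa [ae_iff] using hν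
  have hpos : ∀ᵐ x ∂ν, x ∈ Set.Ioi (0 : ℝ) := by
    filter_upwards [hnonneg, hne] with x h1 h2 using lt_of_le_of_ne h1 h2.symm
  have hn : ∀ᵐ x ∂nmconv ν n, x ∈ Set.Ici (0 : ℝ) :=
    ae_nmconv hpos measurableSet_Ici Set.self_mem_Ici
      (fun x hx y hy => by simp only [Set.mem_Ioi, Set.mem_Ici] at *; linarith) n
  have hc : ∀ᵐ x ∂nmconv ν (n + 1), x ∈ Set.Ioi (0 : ℝ) :=
    ae_mconv hpos hn measurableSet_Ioi
      (fun x hx y hy => by simp only [Set.mem_Ioi, Set.mem_Ici] at *; linarith)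
  exact h0.ne' (measure_mono_null (by simp) (ae_iff.1 hc))

/-- A convolution root of a law on `ℕ` charging `0` is a law on `ℕ`. -/
lemma root_ae_natSet {ν : Measure ℝ} [IsProbabilityMeasure ν] {n : ℕ}
    (h : ∀ᵐ x ∂nmconv ν (n + 1), x ∈ natSet) (h0 : 0 < ν {0}) : ∀ᵐ x ∂ν, x ∈ natSet := by
  have h1 : ν natSetᶜ * ν {0} ^ n ≤ nmconv ν (n + 1) natSetᶜ :=
    (mul_le_mul_right (pow_le_nmconv ν (measurableSet_singleton 0) rfl
      (fun x hx y hy => by simp_all) n) _).trans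
      (mul_le_mconv ν _ measurableSet_natSet.compl (fun x hx y hy => by
        rw [Set.mem_singleton_iff.1 hy, add_zero]; exact hx))
  rw [show nmconv ν (n + 1) natSetᶜ = 0 from ae_iff.1 h, nonpos_iff_eq_zero, mul_eq_zero] at h1
  exact ae_iff.2 (h1.resolve_right (pow_ne_zero _ h0.ne'))

/-- The generating series of the masses of `ν` at the nonnegative integers. -/
noncomputable def genSeries (ν : Measure ℝ) : PowerSeries ℝ :=
  PowerSeries.mk fun k => ν.real {(k : ℝ)}

lemma genSeries_mconv {μ ν : Measure ℝ} [IsProbabilityMeasure μ] [IsProbabilityMeasure ν]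
    (hμ : ∀ᵐ x ∂μ, x ∈ natSet) (hν : ∀ᵐ x ∂ν, x ∈ natSet) :
    genSeries (mconv μ ν) = genSeries μ * genSeries ν := by
  ext k
  simp only [genSeries, PowerSeries.coeff_mul, PowerSeries.coeff_mk]
  have hset : (fun p : ℝ × ℝ => p.1 + p.2) ⁻¹' {(k : ℝ)} =ᵐ[μ.prod ν]
      ⋃ p ∈ Finset.HasAntidiagonal.antidiagonal k, {(p.1 : ℝ)} ×ˢ {(p.2 : ℝ)} := by
    rw [eventuallyEq_set]
    filter_upwards [Measure.quasiMeasurePreserving_fst.ae hμ,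
      Measure.quasiMeasurePreserving_snd.ae hν] with p h1 h2
    obtain ⟨x, y⟩ := p
    obtain ⟨a, rfl⟩ := h1
    obtain ⟨b, rfl⟩ := h2
    simp only [Set.mem_preimage, Set.mem_singleton_iff, Set.mem_iUnion, Set.mem_prod,
      Finset.HasAntidiagonal.mem_antidiagonal, Nat.cast_inj, exists_prop, Prod.exists]
    norm_cast
    constructor
    · intro h
      exact ⟨a, b, h, rfl, rfl⟩
    · rintro ⟨a', b', h, rfl, rfl⟩
      exact h
  rw [mconv, measureReal_def, Measure.map_apply (by fun_prop) (measurableSet_singleton _),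
    measure_congr hset, ← measureReal_def, measureReal_biUnion_finset]
  · refine Finset.sum_congr rfl fun p _ => ?_
    rw [measureReal_prod_prod]
  · intro p _ q _ hpq
    simp only [Function.onFun, Set.disjoint_left, Set.mem_prod, Set.mem_singleton_iff]
    rintro ⟨x, y⟩ ⟨h1, h2⟩ ⟨h3, h4⟩
    simp only at h1 h2 h3 h4
    exact hpq (Prod.ext (by exact_mod_cast h1.symm.trans h3) (by exact_mod_cast h2.symm.trans h4))
  · intro p _
    exact (measurableSet_singleton _).prod (measurableSet_singleton _)

lemma genSeries_nmconv {ν : Measure ℝ} [IsProbabilityMeasure ν]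
    (hν : ∀ᵐ x ∂ν, x ∈ natSet) (n : ℕ) : genSeries (nmconv ν n) = genSeries ν ^ n := by
  induction n with
  | zero =>
    ext k
    simp only [genSeries, nmconv, PowerSeries.coeff_mk, pow_zero, PowerSeries.coeff_one,
      measureReal_def]
    rw [Measure.dirac_apply' _ (measurableSet_singleton _)]
    by_cases hk : k = 0
    · simp [hk]
    · simp [hk]
  | succ n ih =>
    rw [pow_succ', ← ih]
    exact genSeries_mconv hν
      (ae_nmconv hν measurableSet_natSet ⟨0, by simp⟩ (fun x hx y hy => natSet_add hx hy) n)

lemma coeff_pow_nonneg {t : PowerSeries ℝ} (ht : ∀ k, 0 ≤ t.coeff k) (j k : ℕ) :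
    0 ≤ (t ^ j).coeff k := by
  induction j generalizing k with
  | zero => rw [pow_zero, PowerSeries.coeff_one]; split_ifs <;> norm_num
  | succ j ih =>
    rw [pow_succ', PowerSeries.coeff_mul]
    exact Finset.sum_nonneg fun p _ => mul_nonneg (ht _) (ih _)

/-- For a series with nonnegative coefficients and positive constant term, positivity of the
`k`-th coefficient of the `N`-th power does not depend on `N ≥ k`. -/
lemma coeff_pow_pos_iff {r : PowerSeries ℝ} (hr : ∀ k, 0 ≤ r.coeff k) (h0 : 0 < r.coeff 0)
    {k N : ℕ} (hN : k ≤ N) :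
    0 < (r ^ N).coeff k ↔ ∃ j ≤ k, 0 < ((r - PowerSeries.C (r.coeff 0)) ^ j).coeff k := by
  set c := r.coeff 0 with hc
  set t := r - PowerSeries.C c with ht
  have ht0 : PowerSeries.constantCoeff t = 0 := by
    rw [ht, ← PowerSeries.coeff_zero_eq_constantCoeff_apply, map_sub, ← hc]
    simp
  have htk : ∀ k, 0 ≤ t.coeff k := by
    intro k
    rcases Nat.eq_zero_or_pos k with rfl | hk
    · rw [PowerSeries.coeff_zero_eq_constantCoeff_apply, ht0]
    · rw [ht, map_sub, PowerSeries.coeff_C, if_neg hk.ne', sub_zero]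
      exact hr k
  have hcoeff : (r ^ N).coeff k =
      ∑ j ∈ Finset.range (N + 1), (t ^ j).coeff k * (c ^ (N - j) * (N.choose j : ℝ)) := by
    rw [show r = t + PowerSeries.C c by rw [ht]; ring, add_pow, map_sum]
    refine Finset.sum_congr rfl fun j _ => ?_
    rw [mul_assoc, ← map_pow, ← map_natCast (PowerSeries.C (R := ℝ)), ← map_mul,
      PowerSeries.coeff_mul_C]
  have hterm : ∀ j ∈ Finset.range (N + 1),
      0 ≤ (t ^ j).coeff k * (c ^ (N - j) * (N.choose j : ℝ)) := fun j _ =>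
    mul_nonneg (coeff_pow_nonneg htk j k) (by positivity)
  rw [hcoeff, Finset.sum_pos_iff_of_nonneg hterm]
  constructor
  · rintro ⟨j, -, hj⟩
    refine ⟨j, ?_, pos_of_mul_pos_left hj (by positivity)⟩
    by_contra hjk
    rw [PowerSeries.coeff_of_lt_order, zero_mul] at hj
    · exact hj.false
    · exact lt_of_lt_of_le (by exact_mod_cast not_le.1 hjk)
        (PowerSeries.le_order_pow_of_constantCoeff_eq_zero j ht0)
  · rintro ⟨j, hjk, hj⟩
    refine ⟨j, Finset.mem_range.2 (by omega), mul_pos hj (mul_pos (by positivity) ?_)⟩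
    exact_mod_cast Nat.choose_pos (hjk.trans hN)

/-- Positive roots of power series with positive constant term are unique. -/
lemma powerSeries_pow_injective {q r : PowerSeries ℝ} (hq : 0 < q.coeff 0) (hr : 0 < r.coeff 0)
    {n : ℕ} (h : q ^ (n + 1) = r ^ (n + 1)) : q = r := by
  have hg := Commute.geom_sum₂_mul (Commute.all q r) (n + 1)
  rw [h, sub_self, mul_eq_zero] at hg
  refine sub_eq_zero.1 (hg.resolve_left fun hs => ?_)
  have := congrArg PowerSeries.constantCoeff hs
  rw [PowerSeries.coeff_zero_eq_constantCoeff_apply] at hq hr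
  simp only [map_sum, map_mul, map_pow, map_zero] at this
  refine (Finset.sum_pos (fun i _ => ?_) ⟨0, by simp⟩).ne' this
  positivity

lemma coeff_genSeries_pos {ν : Measure ℝ} [IsProbabilityMeasure ν] {k : ℕ} :
    0 < (genSeries ν).coeff k ↔ 0 < ν {(k : ℝ)} := by
  rw [genSeries, PowerSeries.coeff_mk, measureReal_def, ENNReal.toReal_pos_iff]
  simp [measure_lt_top]

lemma support_subset_of_atoms {μ ν : Measure ℝ} (hμ : ∀ᵐ x ∂μ, x ∈ natSet)
    (h : ∀ k : ℕ, 0 < μ {(k : ℝ)} → 0 < ν {(k : ℝ)}) : μ.support ⊆ ν.support := by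
  refine Measure.AbsolutelyContinuous.support_mono fun s hs => ?_
  have hcount : μ (s ∩ natSet) = 0 := by
    refine (measure_null_iff_singleton ((Set.countable_range _).mono Set.inter_subset_right)).2 ?_
    rintro _ ⟨hx, k, rfl⟩
    by_contra hk
    exact (h k (pos_iff_ne_zero.2 hk)).ne' (measure_mono_null (by simpa using hx) hs)
  rw [← measure_inter_add_sdiff s measurableSet_natSet, hcount, zero_add]
  exact measure_mono_null (fun x hx => hx.2) (ae_iff.1 hμ)

lemma root_atom_pos_iff {μ ν : Measure ℝ} [IsProbabilityMeasure μ] [IsProbabilityMeasure ν]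
    (hμ : ∀ᵐ x ∂μ, x ∈ natSet) (h0 : 0 < μ {0})
    (hID : ∀ n : ℕ, 1 ≤ n → ∃ ν : Measure ℝ, IsProbabilityMeasure ν ∧ nmconv ν n = μ)
    {n : ℕ} (hν : nmconv ν (n + 1) = μ) (k : ℕ) : 0 < ν {(k : ℝ)} ↔ 0 < μ {(k : ℝ)} := by
  have hμ0 : ∀ᵐ x ∂μ, 0 ≤ x := by
    filter_upwards [hμ] with x hx
    obtain ⟨a, rfl⟩ := hx
    positivity
  have key : ∀ (ρ : Measure ℝ) [IsProbabilityMeasure ρ] (N : ℕ), nmconv ρ (N + 1) = μ →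
      0 < (genSeries ρ).coeff 0 ∧ genSeries ρ ^ (N + 1) = genSeries μ := by
    intro ρ _ N hρ
    have hpos : 0 < ρ {0} := root_singleton_zero_pos (n := N) (hρ ▸ hμ0) (hρ ▸ h0)
    have hnat := root_ae_natSet (n := N) (hρ ▸ hμ) hpos
    exact ⟨coeff_genSeries_pos.2 (by simpa using hpos), by rw [← genSeries_nmconv hnat, hρ]⟩
  obtain ⟨ρ, _, hρ⟩ := hID ((k + 1) * (n + 1)) (Nat.mul_pos k.succ_pos n.succ_pos)
  obtain ⟨hν0, hνp⟩ := key ν n hν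
  obtain ⟨M, hM⟩ : ∃ M, (k + 1) * (n + 1) = M + 1 :=
    ⟨_, (Nat.succ_pred_eq_of_pos (Nat.mul_pos k.succ_pos n.succ_pos)).symm⟩
  obtain ⟨hρ0, hρp⟩ := key ρ M (hM ▸ hρ)
  have hroot : genSeries ν = genSeries ρ ^ (k + 1) := by
    refine powerSeries_pow_injective hν0 ?_ (n := n) ?_
    · rw [PowerSeries.coeff_zero_eq_constantCoeff_apply] at hρ0 ⊢
      rw [map_pow]
      positivity
    · rw [hνp, ← pow_mul, hM, hρp]
  have hnonneg : ∀ k, 0 ≤ (genSeries ρ).coeff k := fun k => by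
    rw [genSeries, PowerSeries.coeff_mk]
    exact measureReal_nonneg
  rw [← coeff_genSeries_pos, ← coeff_genSeries_pos, hroot, ← hρp, ← hM,
    coeff_pow_pos_iff hnonneg hρ0 (Nat.le_succ k), coeff_pow_pos_iff hnonneg hρ0 (by nlinarith)]

/-- If a square root of a law on `ℕ` has the same support, the law charges `0`. -/
lemma singleton_zero_pos_of_support_eq {μ ν : Measure ℝ} [IsProbabilityMeasure μ]
    [IsProbabilityMeasure ν] (hμ : ∀ᵐ x ∂μ, x ∈ natSet) (hν : nmconv ν 2 = μ)
    (hs : ν.support = μ.support) : 0 < μ {0} := by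
  classical
  have hex : ∃ m : ℕ, 0 < μ {(m : ℝ)} := by
    by_contra! hno
    have hsub := support_subset_of_atoms (ν := 0) hμ fun k hk => absurd hk (hno k).not_gt
    rw [Measure.support_zero] at hsub
    exact (Measure.nonempty_support (IsProbabilityMeasure.ne_zero μ)).ne_empty
      (Set.subset_empty_iff.1 hsub)
  set m := Nat.find hex with hm
  have hmpos : 0 < μ {(m : ℝ)} := Nat.find_spec hex
  have hsupp : μ.support ⊆ Set.Ici (m : ℝ) := by
    refine Measure.support_subset_of_isClosed isClosed_Ici ?_
    have hne : ∀ k : ℕ, ∀ᵐ x ∂μ, k < m → x ≠ (k : ℝ) := fun k => by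
      by_cases hk : k < m
      · simpa [hk, ae_iff] using Nat.find_min hex hk
      · simp [hk]
    filter_upwards [hμ, ae_all_iff.2 hne] with x hx hxk
    obtain ⟨a, rfl⟩ := hx
    simp only [Set.mem_Ici, Nat.cast_le]
    by_contra hlt
    exact hxk a (not_le.1 hlt) rfl
  have hνm : ∀ᵐ x ∂ν, x ∈ Set.Ici (m : ℝ) :=
    Filter.mem_of_superset Measure.support_mem_ae (hs ▸ hsupp)
  have h1 : ∀ᵐ x ∂nmconv ν 1, x ∈ Set.Ici (m : ℝ) :=
    ae_mconv (B := {0}) hνm ((ae_dirac_iff (measurableSet_singleton 0)).2 rfl) measurableSet_Ici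
      (fun x hx y hy => by rw [Set.mem_singleton_iff.1 hy, add_zero]; exact hx)
  have h2 : ∀ᵐ x ∂nmconv ν 2, x ∈ Set.Ici (m + m : ℝ) :=
    ae_mconv hνm h1 measurableSet_Ici (fun x hx y hy => Set.mem_Ici.2 (add_le_add hx hy))
  rw [hν] at h2
  have hm0 : m = 0 := by
    by_contra hne
    have hlt : (0 : ℝ) < m := by exact_mod_cast Nat.pos_of_ne_zero hne
    refine hmpos.ne' (measure_mono_null ?_ (ae_iff.1 h2))
    simpa using hlt
  simpa [hm0] using hmpos

/-- For an infinitely divisible probability measure μ on ℝ concentrated on the nonnegative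
integers, μ({0}) > 0 iff for every n ≥ 1 every n-th convolution root of μ has the same
topological support as μ. -/
theorem stmt_2 (μ : Measure ℝ) [IsProbabilityMeasure μ]
    (hconc : μ (Set.range (fun n : ℕ => (n : ℝ))) = 1)
    (hID : ∀ n : ℕ, 1 ≤ n → ∃ ν : Measure ℝ, IsProbabilityMeasure ν ∧ nmconv ν n = μ) :
    0 < μ {0} ↔
      ∀ n : ℕ, 1 ≤ n → ∀ ν : Measure ℝ, IsProbabilityMeasure ν → nmconv ν n = μ →
        msupport ν = msupport μ := by
  have hμ : ∀ᵐ x ∂μ, x ∈ natSet := (mem_ae_iff_prob_eq_one measurableSet_natSet).2 hconc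
  constructor
  · intro h0 n hn ν _ hν
    obtain ⟨n, rfl⟩ : ∃ k, n = k + 1 := ⟨n - 1, by omega⟩
    have hatom := root_atom_pos_iff hμ h0 hID hν
    have hμ0 : ∀ᵐ x ∂nmconv ν (n + 1), 0 ≤ x := by
      rw [hν]
      filter_upwards [hμ] with x hx
      obtain ⟨a, rfl⟩ := hx
      positivity
    have hνnat := root_ae_natSet (n := n) (hν.symm ▸ hμ)
      (root_singleton_zero_pos hμ0 (hν.symm ▸ h0))
    rw [msupport_eq_support, msupport_eq_support]
    exact (support_subset_of_atoms hνnat fun k => (hatom k).1).antisymm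
      (support_subset_of_atoms hμ fun k => (hatom k).2)
  · intro h
    obtain ⟨ν, hp, hν⟩ := hID 2 one_le_two
    refine singleton_zero_pos_of_support_eq hμ hν ?_
    rw [← msupport_eq_support, ← msupport_eq_support]
    exact h 2 one_le_two ν hp hν
end

section
/- If a probability mass function p on the nonnegative integers is infinitely divisible with integer-valued components and satisfies p(1) > 0, then p has no gaps in its support: p(n) > 0 for every nonnegative integer n. -/
/-- `p` is a probability mass function on the nonnegative integers. -/
def IsPMF (p : ℕ → ℝ) : Prop := (∀ n, 0 ≤ p n) ∧ HasSum p 1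

/-- Convolution of two mass functions on ℕ. -/
def conv (q r : ℕ → ℝ) : ℕ → ℝ := fun m => ∑ j ∈ Finset.range (m + 1), q j * r (m - j)

/-- n-fold convolution of `q` (with `nconv q 0` the point mass at 0). -/
def nconv (q : ℕ → ℝ) : ℕ → ℕ → ℝ
  | 0 => fun m => if m = 0 then 1 else 0
  | n + 1 => conv q (nconv q n)

theorem nconv_nonneg {q : ℕ → ℝ} (hq : ∀ m, 0 ≤ q m) (n m : ℕ) : 0 ≤ nconv q n m := by
  induction n generalizing m with
  | zero => simp only [nconv]; split_ifs <;> norm_num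
  | succ n ih =>
    simp only [nconv, conv]
    exact Finset.sum_nonneg fun j _ => mul_nonneg (hq j) (ih _)

theorem nconv_one_eq_zero {q : ℕ → ℝ} (h : q 1 = 0) (n : ℕ) : nconv q n 1 = 0 := by
  induction n with
  | zero => simp [nconv]
  | succ n ih => simp [nconv, conv, Finset.sum_range_succ, h, ih]

theorem nconv_self_pos {q : ℕ → ℝ} (hq : ∀ m, 0 ≤ q m) (h : 0 < q 1) (n : ℕ) :
    0 < nconv q n n := by
  induction n with
  | zero => simp [nconv]
  | succ n ih =>
    simp only [nconv, conv]
    refine Finset.sum_pos' (fun j _ => mul_nonneg (hq j) (nconv_nonneg hq _ _)) ⟨1, ?_, ?_⟩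
    · simp
    · simpa using mul_pos h ih

theorem nconv_two_zero (q : ℕ → ℝ) : nconv q 2 0 = q 0 * q 0 := by
  simp [nconv, conv]

theorem nconv_two_one (q : ℕ → ℝ) : nconv q 2 1 = 2 * (q 0 * q 1) := by
  simp [nconv, conv, Finset.sum_range_succ]
  ring

/-- If a pmf on ℕ is infinitely divisible with integer-valued components and p 1 > 0,
then p has no gaps in its support: p n > 0 for every nonnegative integer n. -/
theorem stmt_3 (p : ℕ → ℝ) (hp : IsPMF p)
    (hID : ∀ n : ℕ, 1 ≤ n → ∃ q : ℕ → ℝ, IsPMF q ∧ nconv q n = p)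
    (h1 : 0 < p 1) :
    ∀ n : ℕ, 0 < p n := by
  intro n
  rcases Nat.eq_zero_or_pos n with rfl | hn
  · obtain ⟨q, -, rfl⟩ := hID 2 (by norm_num)
    rw [nconv_two_zero]
    refine mul_self_pos.2 fun h0 => h1.ne' ?_
    rw [nconv_two_one, h0, zero_mul, mul_zero]
  · obtain ⟨q, hq, rfl⟩ := hID n hn
    refine nconv_self_pos hq.1 ((hq.1 1).lt_of_ne' fun h => ?_) n
    exact h1.ne' (nconv_one_eq_zero h n)
end

section
/- If φ is the Laplace transform of a probability measure μ on [0, ∞), i.e., φ(s) = ∫ e^{−sx} dμ(x), then s ↦ φ(1 − s) is a probability generating function: there exists a probability mass function p on the nonnegative integers such that ∑_{n≥0} p(n) s^n = φ(1 − s) for all s with 0 < s < 1. -/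
open MeasureTheory

/-- Mixing Poisson weights over a probability measure on `[0, ∞)`: the power series with the mixed
Poisson weights as coefficients sums to the Laplace transform at `1 - s`. -/
theorem hasSum_integral_poisson_mul_pow (μ : Measure ℝ) [IsProbabilityMeasure μ]
    (hμ : ∀ᵐ x ∂μ, 0 ≤ x) {s : ℝ} (hs0 : 0 ≤ s) (hs1 : s ≤ 1) :
    HasSum (fun n : ℕ => (∫ x, Real.exp (-x) * (x ^ n / n.factorial) ∂μ) * s ^ n)
      (∫ x, Real.exp (-(1 - s) * x) ∂μ) := by
  have hsum (x : ℝ) : HasSum (fun n : ℕ => Real.exp (-x) * (x ^ n / n.factorial) * s ^ n)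
      (Real.exp (-(1 - s) * x)) := by
    have h := (NormedSpace.expSeries_div_hasSum_exp (s * x)).mul_left (Real.exp (-x))
    rw [← Real.exp_eq_exp_ℝ, ← Real.exp_add] at h
    have hexp : -(1 - s) * x = -x + s * x := by ring
    rw [hexp]
    refine (funext fun n => ?_ : (fun n : ℕ => Real.exp (-x) * (x ^ n / n.factorial) * s ^ n) =
      fun n : ℕ => Real.exp (-x) * ((s * x) ^ n / n.factorial)) ▸ h
    rw [mul_pow]
    ring
  simp_rw [← integral_mul_const]
  refine hasSum_integral_of_dominated_convergence
    (fun n x => Real.exp (-x) * (x ^ n / n.factorial) * s ^ n) (fun n => ?_) (fun n => ?_)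
    (.of_forall fun x => (hsum x).summable) ?_ (.of_forall hsum)
  · exact Continuous.aestronglyMeasurable (by fun_prop)
  · filter_upwards [hμ] with x hx
    rw [Real.norm_of_nonneg (by positivity)]
  · simp_rw [fun x => (hsum x).tsum_eq]
    refine Integrable.of_bound (C := 1) (Continuous.aestronglyMeasurable (by fun_prop)) ?_
    filter_upwards [hμ] with x hx
    rw [Real.norm_of_nonneg (Real.exp_nonneg _), Real.exp_le_one_iff]
    nlinarith

/-- If φ is the Laplace transform of a probability measure on [0, ∞), then s ↦ φ(1 - s)
is a probability generating function on (0, 1). -/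
theorem stmt_8 (μ : Measure ℝ) [IsProbabilityMeasure μ] (hpos : μ (Set.Ici (0 : ℝ)) = 1)
    (φ : ℝ → ℝ) (hφ : ∀ s : ℝ, 0 ≤ s → φ s = ∫ x, Real.exp (-s * x) ∂μ) :
    ∃ p : ℕ → ℝ, IsPMF p ∧
      ∀ s : ℝ, s ∈ Set.Ioo (0 : ℝ) 1 → HasSum (fun n : ℕ => p n * s ^ n) (φ (1 - s)) := by
  have hμ : ∀ᵐ x ∂μ, 0 ≤ x := (prob_compl_eq_zero_iff measurableSet_Ici).2 hpos
  refine ⟨fun n => ∫ x, Real.exp (-x) * (x ^ n / n.factorial) ∂μ, ⟨fun n => ?_, ?_⟩, fun s hs => ?_⟩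
  · refine integral_nonneg_of_ae ?_
    filter_upwards [hμ] with x hx
    simp only [Pi.zero_apply]
    positivity
  · simpa using hasSum_integral_poisson_mul_pow μ hμ zero_le_one le_rfl
  · rw [hφ _ (sub_nonneg.2 hs.2.le)]
    exact hasSum_integral_poisson_mul_pow μ hμ hs.1.le hs.2.le
end

section
/- Let p be a probability mass function on the nonnegative integers and let f : (0, ∞) → ℝ be a completely monotone function (f is infinitely differentiable on (0, ∞) and (−1)^n f^{(n)}(s) ≥ 0 for all s > 0 and all n ≥ 0) satisfying f(s) = ∑_{n≥0} p(n) (1 − s)^n for all s with 0 < s < 1. Then f is the Laplace transform of a probability measure: there exists a probability measure μ on [0, ∞) such that ∫ e^{−sx} dμ(x) = f(s) for all s > 0. -/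
open MeasureTheory

open Filter Topology Set
open scoped Nat

/-- `f` is completely monotone on `(0, ∞)`. -/
structure IsCompletelyMonotone (f : ℝ → ℝ) : Prop where
  contDiffOn : ContDiffOn ℝ (⊤ : ℕ∞) f (Ioi (0 : ℝ))
  nonneg : ∀ (n : ℕ) (s : ℝ), 0 < s → 0 ≤ (-1 : ℝ) ^ n * iteratedDerivWithin n f (Ioi (0 : ℝ)) s

namespace IsCompletelyMonotone

variable {f : ℝ → ℝ}

/-- Mean value form of the Taylor remainder, on `(0, ∞)`. -/
theorem exists_taylor_remainder (hf : IsCompletelyMonotone f) (n : ℕ) {x b : ℝ} (hx : 0 < x)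
    (hxb : x < b) :
    ∃ ξ ∈ Ioo x b, f x - taylorWithinEval f n (Ioi 0) b x =
      (ξ - x) ^ n * (b - x) / n ! *
        ((-1 : ℝ) ^ (n + 1) * iteratedDerivWithin (n + 1) f (Ioi 0) ξ) := by
  have hd : ∀ t ∈ Ioi (0 : ℝ), HasDerivAt (fun t => taylorWithinEval f n (Ioi 0) t x)
      (((n ! : ℝ)⁻¹ * (x - t) ^ n) • iteratedDerivWithin (n + 1) f (Ioi 0) t) t := by
    intro t ht
    refine (hasDerivWithinAt_taylorWithinEval (uniqueDiffOn_Ioi 0) self_mem_nhdsWithin ht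
      subset_rfl (hf.contDiffOn.of_le (by exact_mod_cast le_top)) ?_).hasDerivAt (Ioi_mem_nhds ht)
    exact hf.contDiffOn.differentiableOn_iteratedDerivWithin
      (by exact_mod_cast WithTop.coe_lt_top n) (uniqueDiffOn_Ioi 0) t ht
  obtain ⟨ξ, hξ, h⟩ := exists_hasDerivAt_eq_slope (fun t => taylorWithinEval f n (Ioi 0) t x) _ hxb
    (fun t ht => (hd t (hx.trans_le ht.1)).continuousAt.continuousWithinAt)
    (fun t ht => hd t (hx.trans ht.1))
  refine ⟨ξ, hξ, ?_⟩
  rw [eq_div_iff (sub_pos.2 hxb).ne', taylorWithinEval_self, smul_eq_mul] at h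
  have hs : (x - ξ) ^ n = (-1) ^ n * (ξ - x) ^ n := by rw [← mul_pow]; ring
  rw [hs] at h
  linear_combination h

theorem taylorWithinEval_eq (f : ℝ → ℝ) (n : ℕ) (b x : ℝ) :
    taylorWithinEval f n (Ioi 0) b x = ∑ k ∈ Finset.range (n + 1),
      (b - x) ^ k / k ! * ((-1 : ℝ) ^ k * iteratedDerivWithin k f (Ioi 0) b) := by
  rw [taylor_within_apply]
  refine Finset.sum_congr rfl fun k _ => ?_
  have hs : (x - b) ^ k = (-1) ^ k * (b - x) ^ k := by rw [← mul_pow]; ring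
  rw [hs, smul_eq_mul]
  ring

theorem taylorWithinEval_le (hf : IsCompletelyMonotone f) (n : ℕ) {x b : ℝ} (hx : 0 < x)
    (hxb : x < b) : taylorWithinEval f n (Ioi 0) b x ≤ f x := by
  obtain ⟨ξ, hξ, h⟩ := hf.exists_taylor_remainder n hx hxb
  have h1 := hf.nonneg (n + 1) ξ (hx.trans hξ.1)
  have h2 : 0 ≤ (ξ - x) ^ n * (b - x) / n ! :=
    div_nonneg (mul_nonneg (pow_nonneg (sub_pos.2 hξ.1).le _) (sub_pos.2 hxb).le) (by positivity)
  have := mul_nonneg h2 h1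
  linarith

theorem taylor_term_le (hf : IsCompletelyMonotone f) (n : ℕ) {x b : ℝ} (hx : 0 < x)
    (hxb : x < b) :
    (b - x) ^ n / n ! * ((-1 : ℝ) ^ n * iteratedDerivWithin n f (Ioi 0) b) ≤ f x := by
  refine le_trans ?_ (hf.taylorWithinEval_le n hx hxb)
  rw [taylorWithinEval_eq]
  refine Finset.single_le_sum (f := fun k => (b - x) ^ k / k ! *
    ((-1 : ℝ) ^ k * iteratedDerivWithin k f (Ioi 0) b)) (fun k _ => ?_) (Finset.self_mem_range_succ n)
  exact mul_nonneg (div_nonneg (pow_nonneg (sub_pos.2 hxb).le _) (by positivity))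
    (hf.nonneg k b (hx.trans hxb))

/-- A completely monotone function is the sum of its Taylor series at `b` on `(0, b)`. -/
theorem hasSum_taylor (hf : IsCompletelyMonotone f) {x b : ℝ} (hx : 0 < x) (hxb : x < b) :
    HasSum (fun k : ℕ => (b - x) ^ k / k ! * ((-1 : ℝ) ^ k * iteratedDerivWithin k f (Ioi 0) b))
      (f x) := by
  have hbx := sub_pos.2 hxb
  rw [hasSum_iff_tendsto_nat_of_nonneg
    (fun k => mul_nonneg (by positivity) (hf.nonneg k b (hx.trans hxb)))]
  rw [← tendsto_add_atTop_iff_nat 1]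
  set a := x / 2 with ha
  have ha0 : 0 < a := by positivity
  have hax : a < x := half_lt_self hx
  set r := (b - x) / (b - a) with hr
  have hba : 0 < b - a := by linarith
  have hr0 : 0 ≤ r := by positivity
  have hr1 : r < 1 := by rw [hr, div_lt_one hba]; linarith
  have hbound : ∀ n : ℕ, f x - taylorWithinEval f n (Ioi 0) b x ≤
      f a * (b - x) / (x - a) * (n * r ^ n + r ^ n) := by
    intro n
    obtain ⟨ξ, ⟨h1, h2⟩, h⟩ := hf.exists_taylor_remainder n hx hxb
    rw [h]
    have hT := hf.taylor_term_le (n + 1) ha0 (hax.trans h1)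
    have hD := hf.nonneg (n + 1) ξ (hx.trans h1)
    set D := (-1 : ℝ) ^ (n + 1) * iteratedDerivWithin (n + 1) f (Ioi 0) ξ
    have hξa : 0 < ξ - a := by linarith
    have hξx : 0 < ξ - x := by linarith
    have hxa : 0 < x - a := by linarith
    have hfa : 0 ≤ f a := le_trans (by positivity) hT
    have hq : (ξ - x) / (ξ - a) ≤ r := by
      rw [hr, div_le_div_iff₀ hξa hba]
      nlinarith
    have hq' : ((ξ - x) / (ξ - a)) ^ n ≤ r ^ n := pow_le_pow_left₀ (by positivity) hq n
    calc (ξ - x) ^ n * (b - x) / n ! * D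
        = ((ξ - a) ^ (n + 1) / (n + 1)! * D) * ((b - x) / (ξ - a)) *
            ((n + 1) * ((ξ - x) / (ξ - a)) ^ n) := by
          rw [Nat.factorial_succ, div_pow]; push_cast; field_simp; ring
      _ ≤ f a * ((b - x) / (x - a)) * ((n + 1) * r ^ n) := by gcongr
      _ = _ := by ring
  have hlim : Tendsto (fun n : ℕ => f a * (b - x) / (x - a) * (n * r ^ n + r ^ n)) atTop (𝓝 0) := by
    have := ((tendsto_self_mul_const_pow_of_lt_one hr0 hr1).add
      (tendsto_pow_atTop_nhds_zero_of_lt_one hr0 hr1)).const_mul (f a * (b - x) / (x - a))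
    simpa using this
  have h0 : Tendsto (fun n : ℕ => f x - taylorWithinEval f n (Ioi 0) b x) atTop (𝓝 0) :=
    squeeze_zero (fun n => sub_nonneg.2 (hf.taylorWithinEval_le n hx hxb)) hbound hlim
  have := h0.const_sub (f x)
  simpa [taylorWithinEval_eq] using this

/-- If `f` is completely monotone with `f(0+) = 1`, then its Taylor coefficients at `b`, scaled
by `b ^ k`, form a probability mass function. -/
theorem isPMF_taylor (hf : IsCompletelyMonotone f) (h0 : Tendsto f (𝓝[>] 0) (𝓝 1)) {b : ℝ}
    (hb : 0 < b) :
    IsPMF fun k : ℕ => b ^ k / k ! * ((-1 : ℝ) ^ k * iteratedDerivWithin k f (Ioi 0) b) := by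
  set q := fun k : ℕ => b ^ k / k ! * ((-1 : ℝ) ^ k * iteratedDerivWithin k f (Ioi 0) b)
  have hq : ∀ k, 0 ≤ q k := fun k => mul_nonneg (by positivity) (hf.nonneg k b hb)
  have hev : ∀ᶠ x in 𝓝[>] (0 : ℝ), x ∈ Ioo 0 b := Ioo_mem_nhdsGT hb
  have hpart : ∀ M : ℕ, ∑ k ∈ Finset.range M, q k ≤ 1 := by
    intro M
    have hc : Tendsto (fun x : ℝ => ∑ k ∈ Finset.range M, (b - x) ^ k / k ! *
        ((-1 : ℝ) ^ k * iteratedDerivWithin k f (Ioi 0) b)) (𝓝[>] 0)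
        (𝓝 (∑ k ∈ Finset.range M, q k)) := by
      have : Continuous fun x : ℝ => ∑ k ∈ Finset.range M, (b - x) ^ k / k ! *
        ((-1 : ℝ) ^ k * iteratedDerivWithin k f (Ioi 0) b) := by fun_prop
      have h := (this.tendsto 0).mono_left (nhdsWithin_le_nhds (s := Ioi 0))
      simpa [q] using h
    refine le_of_tendsto_of_tendsto hc h0 ?_
    filter_upwards [hev] with x hx
    exact sum_le_hasSum _ (fun k _ => mul_nonneg
      (div_nonneg (pow_nonneg (sub_pos.2 hx.2).le _) (by positivity)) (hf.nonneg k b hb))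
      (hf.hasSum_taylor hx.1 hx.2)
  have hs : Summable q := summable_of_sum_range_le hq hpart
  refine ⟨hq, ?_⟩
  have hle : ∑' k, q k ≤ 1 := hs.tsum_le_of_sum_range_le hpart
  have hge : 1 ≤ ∑' k, q k := by
    refine le_of_tendsto h0 ?_
    filter_upwards [hev] with x hx
    refine hasSum_le (fun k => ?_) (hf.hasSum_taylor hx.1 hx.2) hs.hasSum
    have := hf.nonneg k b hb
    have h1 : b - x ≤ b := by linarith [hx.1]
    have h2 : 0 ≤ b - x := by linarith [hx.2]
    simp only [q]
    gcongr
  exact le_antisymm hle hge ▸ hs.hasSum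

end IsCompletelyMonotone

/-- The probability measure on `[0, 1]` with mass `p n` at `y n`. -/
theorem IsPMF.exists_probabilityMeasure {p : ℕ → ℝ} (hp : IsPMF p) (y : ℕ → Icc (0 : ℝ) 1) :
    ∃ ν : ProbabilityMeasure (Icc (0 : ℝ) 1), ∀ g : C(Icc (0 : ℝ) 1, ℝ),
      HasSum (fun n => p n * g (y n)) (∫ t, g t ∂(ν : Measure (Icc (0 : ℝ) 1))) := by
  let μ : Measure (Icc (0 : ℝ) 1) :=
    Measure.sum fun n => ENNReal.ofReal (p n) • Measure.dirac (y n)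
  have hμ : IsProbabilityMeasure μ := by
    constructor
    simp only [μ, Measure.sum_apply _ MeasurableSet.univ, Measure.smul_apply, measure_univ,
      smul_eq_mul, mul_one]
    rw [← ENNReal.ofReal_tsum_of_nonneg hp.1 hp.2.summable, hp.2.tsum_eq, ENNReal.ofReal_one]
  refine ⟨⟨μ, hμ⟩, fun g => ?_⟩
  have hg : Integrable g μ := g.continuous.integrable_of_hasCompactSupport
    (HasCompactSupport.of_compactSpace _)
  have := hasSum_integral_measure hg
  simpa [integral_smul_measure, ENNReal.toReal_ofReal (hp.1 _)] using this

/-- The function `t ↦ t ^ s` on `[0, 1]`. -/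
noncomputable def unitRpow {s : ℝ} (hs : 0 < s) : C(Icc (0 : ℝ) 1, ℝ) where
  toFun t := (t : ℝ) ^ s
  continuous_toFun := continuous_subtype_val.rpow_const fun _ => Or.inr hs.le

theorem tendsto_mul_one_sub_exp_neg_div (s : ℝ) :
    Tendsto (fun N : ℕ => ((N : ℝ) + 1) * (1 - Real.exp (-s / ((N : ℝ) + 1)))) atTop (𝓝 s) := by
  have hd : HasDerivAt (fun t : ℝ => 1 - Real.exp (-s * t)) s 0 := by
    have := (((hasDerivAt_id (0 : ℝ)).const_mul (-s)).exp).const_sub 1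
    simpa using this
  have hl : Tendsto (fun N : ℕ => 1 / ((N : ℝ) + 1)) atTop (𝓝[≠] 0) :=
    tendsto_nhdsWithin_iff.2 ⟨tendsto_one_div_add_atTop_nhds_zero_nat,
      Eventually.of_forall fun N => by simp; positivity⟩
  have := hd.tendsto_slope_zero.comp hl
  simpa [Function.comp_def, div_eq_mul_inv] using this

/-- A completely monotone function with `f(0+) = 1` is the Mellin transform of a probability
measure on `[0, 1]`. -/
theorem IsCompletelyMonotone.exists_integral_rpow_eq {f : ℝ → ℝ} (hf : IsCompletelyMonotone f)
    (h0 : Tendsto f (𝓝[>] 0) (𝓝 1)) :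
    ∃ ν : ProbabilityMeasure (Icc (0 : ℝ) 1), ∀ s : ℝ, 0 < s →
      ∫ t, (t : ℝ) ^ s ∂(ν : Measure (Icc (0 : ℝ) 1)) = f s := by
  have hN : ∀ N : ℕ, (0 : ℝ) < (N : ℝ) + 1 := fun N => by positivity
  let y : ℕ → ℕ → Icc (0 : ℝ) 1 := fun N n => ⟨Real.exp (-(n / ((N : ℝ) + 1))),
    (Real.exp_pos _).le, Real.exp_le_one_iff.2 (neg_nonpos.2 (by positivity))⟩
  choose ν hν using fun N : ℕ =>
    (hf.isPMF_taylor h0 (hN N)).exists_probabilityMeasure (y N)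
  have hint : ∀ (N : ℕ) (s : ℝ) (hs : 0 < s),
      ∫ t, unitRpow hs t ∂(ν N : Measure (Icc (0 : ℝ) 1)) =
        f (((N : ℝ) + 1) * (1 - Real.exp (-s / ((N : ℝ) + 1)))) := by
    intro N s hs
    have hb := hN N
    set b := (N : ℝ) + 1 with hbdef
    have he : Real.exp (-s / b) < 1 :=
      Real.exp_lt_one_iff.2 (div_neg_of_neg_of_pos (neg_neg_of_pos hs) hb)
    refine (hν N (unitRpow hs)).unique ?_
    convert hf.hasSum_taylor (x := b * (1 - Real.exp (-s / b))) (b := b)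
      (mul_pos hb (sub_pos.2 he)) (by nlinarith [Real.exp_pos (-s / b)]) using 2 with n
    have h1 : unitRpow hs (y N n) = Real.exp (-s / b) ^ n := by
      change Real.exp (-(n / b)) ^ s = _
      rw [← Real.exp_mul, ← Real.exp_nat_mul]
      congr 1
      ring
    rw [h1, show b - b * (1 - Real.exp (-s / b)) = b * Real.exp (-s / b) by ring, mul_pow]
    ring
  obtain ⟨ν₀, -, hν₀⟩ := isCompact_univ.ultrafilter_le_nhds ((hyperfilter ℕ).map ν) (by simp)
  have hlim : Tendsto ν (hyperfilter ℕ : Filter ℕ) (𝓝 ν₀) := hν₀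
  refine ⟨ν₀, fun s hs => ?_⟩
  have hA := (ProbabilityMeasure.tendsto_iff_forall_integral_tendsto.1 hlim)
    (BoundedContinuousFunction.mkOfCompact (unitRpow hs))
  simp only [BoundedContinuousFunction.mkOfCompact_apply, hint] at hA
  have hcont : ContinuousAt f s := hf.contDiffOn.continuousOn.continuousAt (Ioi_mem_nhds hs)
  have hB := (hcont.tendsto.comp (tendsto_mul_one_sub_exp_neg_div s)).mono_left
    Nat.hyperfilter_le_atTop
  exact tendsto_nhds_unique hA hB

/-- **Bernstein's theorem**: a completely monotone function with `f(0+) = 1` is the Laplace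
transform of a probability measure on `[0, ∞)`. -/
theorem IsCompletelyMonotone.exists_laplace_eq {f : ℝ → ℝ} (hf : IsCompletelyMonotone f)
    (h0 : Tendsto f (𝓝[>] 0) (𝓝 1)) :
    ∃ μ : Measure ℝ, IsProbabilityMeasure μ ∧ μ (Ici (0 : ℝ)) = 1 ∧
      ∀ s : ℝ, 0 < s → (∫ x, Real.exp (-s * x) ∂μ) = f s := by
  obtain ⟨ν, hν⟩ := hf.exists_integral_rpow_eq h0
  set m : Measure (Icc (0 : ℝ) 1) := (ν : Measure (Icc (0 : ℝ) 1))
  have hpos : ∀ᵐ t : Icc (0 : ℝ) 1 ∂m, 0 < (t : ℝ) := by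
    let A : Set (Icc (0 : ℝ) 1) := {t | 0 < (t : ℝ)}
    have hA : MeasurableSet A := measurableSet_lt measurable_const measurable_subtype_coe
    have hle : 1 ≤ m.real A := by
      refine le_of_tendsto h0 ?_
      filter_upwards [self_mem_nhdsWithin] with s hs
      rw [← hν s hs, ← integral_indicator_one hA]
      refine integral_mono ((unitRpow hs).continuous.integrable_of_hasCompactSupport
        (HasCompactSupport.of_compactSpace _)) ((integrable_const (1 : ℝ)).indicator hA) fun t => ?_
      by_cases ht : t ∈ A
      · simpa [ht] using Real.rpow_le_one t.2.1 t.2.2 (le_of_lt hs)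
      · have : (t : ℝ) = 0 := le_antisymm (not_lt.1 ht) t.2.1
        simp [ht, this, Real.zero_rpow (ne_of_gt hs)]
    refine (mem_ae_iff_prob_eq_one hA).2 (le_antisymm prob_le_one ?_)
    rwa [measureReal_def, ← ENNReal.ofReal_le_iff_le_toReal (measure_ne_top _ _),
      ENNReal.ofReal_one] at hle
  have hmeas : Measurable fun t : Icc (0 : ℝ) 1 => -Real.log t := by fun_prop
  refine ⟨m.map fun t => -Real.log (t : Icc (0 : ℝ) 1), Measure.isProbabilityMeasure_map hmeas.aemeasurable, ?_, ?_⟩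
  · rw [Measure.map_apply hmeas measurableSet_Ici]
    convert measure_univ (μ := m)
    ext t
    simpa using Real.log_nonpos t.2.1 t.2.2
  · intro s hs
    rw [integral_map hmeas.aemeasurable (by fun_prop), ← hν s hs]
    refine integral_congr_ae ?_
    filter_upwards [hpos] with t ht
    rw [Real.rpow_def_of_pos ht]
    congr 1
    ring

/-- The probability generating function tends to `1` at `1`. -/
theorem IsPMF.tendsto_pgf {p : ℕ → ℝ} (hp : IsPMF p) :
    Tendsto (fun s : ℝ => ∑' n, p n * (1 - s) ^ n) (𝓝[>] 0) (𝓝 1) := by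
  suffices h : Tendsto (fun s : ℝ => ∑' n, p n * (1 - s) ^ n) (𝓝[>] 0) (𝓝 (∑' n, p n)) by
    rwa [hp.2.tsum_eq] at h
  refine tendsto_tsum_of_dominated_convergence hp.2.summable (fun n => ?_) ?_
  · have : Continuous fun s : ℝ => p n * (1 - s) ^ n := by fun_prop
    simpa using (this.tendsto 0).mono_left (nhdsWithin_le_nhds (s := Ioi 0))
  · filter_upwards [Ioo_mem_nhdsGT (zero_lt_one (α := ℝ))] with s hs n
    have h1 : 0 ≤ 1 - s := by linarith [hs.2]
    rw [Real.norm_of_nonneg (mul_nonneg (hp.1 n) (pow_nonneg h1 n))]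
    exact mul_le_of_le_one_right (hp.1 n) (pow_le_one₀ h1 (by linarith [hs.1]))

/-- If f is completely monotone on (0, ∞) and f(s) = ∑ p(n) (1-s)^n on (0,1) for a pmf p,
then f is the Laplace transform of a probability measure on [0, ∞). -/
theorem stmt_9 (p : ℕ → ℝ) (hp : IsPMF p) (f : ℝ → ℝ)
    (hsmooth : ContDiffOn ℝ (⊤ : ℕ∞) f (Set.Ioi (0 : ℝ)))
    (hCM : ∀ n : ℕ, ∀ s : ℝ, 0 < s →
      0 ≤ (-1 : ℝ) ^ n * iteratedDerivWithin n f (Set.Ioi (0 : ℝ)) s)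
    (hgen : ∀ s : ℝ, s ∈ Set.Ioo (0 : ℝ) 1 →
      HasSum (fun n : ℕ => p n * (1 - s) ^ n) (f s)) :
    ∃ μ : Measure ℝ, IsProbabilityMeasure μ ∧ μ (Set.Ici (0 : ℝ)) = 1 ∧
      ∀ s : ℝ, 0 < s → (∫ x, Real.exp (-s * x) ∂μ) = f s := by
  refine IsCompletelyMonotone.exists_laplace_eq ⟨hsmooth, hCM⟩ (hp.tendsto_pgf.congr' ?_)
  filter_upwards [Ioo_mem_nhdsGT (zero_lt_one (α := ℝ))] with s hs
  exact (hgen s hs).tsum_eq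
end

section
/- In the discrete case, discrete stable laws and they alone possess a domain of attraction. Precisely: let p be a non-degenerate probability mass function on the nonnegative integers (p is not a point mass) with probability generating function Q. There exist a non-degenerate probability mass function q on the nonnegative integers with probability generating function R and a sequence of constants a_n with 0 < a_n < 1 such that (R(1 − a_n(1 − s)))^n → Q(s) as n → ∞ for every s with 0 ≤ s < 1, if and only if Q(s) = exp(−λ(1 − s)^α) for some λ > 0 and some α with 0 < α ≤ 1. -/
open Filter

/-- `p` is degenerate (a point mass). -/
def IsDegenerate (p : ℕ → ℝ) : Prop := ∃ m₀ : ℕ, ∀ m : ℕ, p m = if m = m₀ then 1 else 0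

section GeneratingFunction

variable {p : ℕ → ℝ} {Q : ℝ → ℝ}

lemma IsPMF.exists_pos_of_not_isDegenerate (hp : IsPMF p) (hnd : ¬ IsDegenerate p) :
    ∃ k, k ≠ 0 ∧ 0 < p k := by
  by_contra! h
  have h0 : ∀ k, k ≠ 0 → p k = 0 := fun k hk => le_antisymm (h k hk) (hp.1 k)
  have h1 : p 0 = 1 := (hasSum_single 0 h0).unique hp.2
  refine hnd ⟨0, fun m => ?_⟩
  split_ifs with hm
  · rw [hm, h1]
  · exact h0 m hm

lemma pgf_nonneg (hp : IsPMF p)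
    (hQ : ∀ s : ℝ, s ∈ Set.Ico (0 : ℝ) 1 → HasSum (fun n : ℕ => p n * s ^ n) (Q s))
    {s : ℝ} (hs : s ∈ Set.Ico (0 : ℝ) 1) : 0 ≤ Q s :=
  (hQ s hs).nonneg fun n => mul_nonneg (hp.1 n) (pow_nonneg hs.1 n)

lemma pgf_monotoneOn (hp : IsPMF p)
    (hQ : ∀ s : ℝ, s ∈ Set.Ico (0 : ℝ) 1 → HasSum (fun n : ℕ => p n * s ^ n) (Q s)) :
    MonotoneOn Q (Set.Ico 0 1) := by
  intro s hs t ht hst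
  exact hasSum_le (fun n => mul_le_mul_of_nonneg_left (pow_le_pow_left₀ hs.1 hst n) (hp.1 n))
    (hQ s hs) (hQ t ht)

lemma pgf_strictMonoOn (hp : IsPMF p) (hnd : ¬ IsDegenerate p)
    (hQ : ∀ s : ℝ, s ∈ Set.Ico (0 : ℝ) 1 → HasSum (fun n : ℕ => p n * s ^ n) (Q s)) :
    StrictMonoOn Q (Set.Ico 0 1) := by
  intro s hs t ht hst
  obtain ⟨k, hk, hpk⟩ := hp.exists_pos_of_not_isDegenerate hnd
  exact hasSum_lt (fun n => mul_le_mul_of_nonneg_left (pow_le_pow_left₀ hs.1 hst.le n) (hp.1 n))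
    (mul_lt_mul_of_pos_left (pow_lt_pow_left₀ hst hs.1 hk) hpk) (hQ s hs) (hQ t ht)

lemma pgf_pos (hp : IsPMF p) (hnd : ¬ IsDegenerate p)
    (hQ : ∀ s : ℝ, s ∈ Set.Ico (0 : ℝ) 1 → HasSum (fun n : ℕ => p n * s ^ n) (Q s))
    {s : ℝ} (hs : s ∈ Set.Ioo (0 : ℝ) 1) : 0 < Q s :=
  (pgf_nonneg hp hQ ⟨le_rfl, one_pos⟩).trans_lt
    (pgf_strictMonoOn hp hnd hQ ⟨le_rfl, one_pos⟩ ⟨hs.1.le, hs.2⟩ hs.1)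

/-- A generating function stays below a chord through `(1, 1)`. -/
lemma exists_pgf_le_one_sub_mul (hp : IsPMF p) (hnd : ¬ IsDegenerate p)
    (hQ : ∀ s : ℝ, s ∈ Set.Ico (0 : ℝ) 1 → HasSum (fun n : ℕ => p n * s ^ n) (Q s)) :
    ∃ b : ℝ, 0 < b ∧ ∀ s ∈ Set.Ico (0 : ℝ) 1, Q s ≤ 1 - b * (1 - s) := by
  obtain ⟨k, hk, hpk⟩ := hp.exists_pos_of_not_isDegenerate hnd
  refine ⟨p k, hpk, fun s hs => ?_⟩
  have h1 := hp.2.sub (hQ s hs)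
  have h2 : p k - p k * s ^ k ≤ 1 - Q s := by
    refine le_hasSum h1 k fun n _ => ?_
    nlinarith [hp.1 n, pow_le_one₀ hs.1 hs.2.le (n := n)]
  have h3 : s ^ k ≤ s := pow_le_of_le_one hs.1 hs.2.le hk
  nlinarith

lemma pgf_continuousOn (hp : IsPMF p)
    (hQ : ∀ s : ℝ, s ∈ Set.Ico (0 : ℝ) 1 → HasSum (fun n : ℕ => p n * s ^ n) (Q s)) :
    ContinuousOn Q (Set.Ico 0 1) := by
  have h : ContinuousOn (fun s : ℝ => ∑' n, p n * s ^ n) (Set.Ico 0 1) := by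
    refine continuousOn_tsum (u := p) (fun n => by fun_prop) hp.2.summable fun n s hs => ?_
    rw [Real.norm_of_nonneg (mul_nonneg (hp.1 n) (pow_nonneg hs.1 n))]
    exact mul_le_of_le_one_right (hp.1 n) (pow_le_one₀ hs.1 hs.2.le)
  exact h.congr fun s hs => (hQ s hs).tsum_eq.symm

lemma two_mul_pgf_midpoint_le (hp : IsPMF p)
    (hQ : ∀ s : ℝ, s ∈ Set.Ico (0 : ℝ) 1 → HasSum (fun n : ℕ => p n * s ^ n) (Q s))
    {s : ℝ} (hs : s ∈ Set.Ico (0 : ℝ) 1) : 2 * Q ((1 + s) / 2) ≤ 1 + Q s := by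
  have hm : (1 + s) / 2 ∈ Set.Ico (0 : ℝ) 1 := ⟨by linarith [hs.1], by linarith [hs.2]⟩
  refine hasSum_le (fun n => ?_) ((hQ _ hm).mul_left 2) (hp.2.add (hQ s hs))
  have h := (convexOn_pow (𝕜 := ℝ) n).2 (Set.mem_Ici.2 zero_le_one) hs.1
    (show (0 : ℝ) ≤ 1 / 2 by norm_num) (show (0 : ℝ) ≤ 1 / 2 by norm_num) (by norm_num)
  simp only [smul_eq_mul, one_pow] at h
  rw [show (1 : ℝ) / 2 * 1 + 1 / 2 * s = (1 + s) / 2 by ring] at h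
  nlinarith [hp.1 n]

end GeneratingFunction

lemma eq_mul_one_of_additive_of_monotoneOn {F : ℝ → ℝ}
    (hadd : ∀ x y, 0 ≤ x → 0 ≤ y → F (x + y) = F x + F y)
    (hmono : MonotoneOn F (Set.Ici 0)) {x : ℝ} (hx : 0 ≤ x) : F x = x * F 1 := by
  have h0 : F 0 = 0 := by
    have := hadd 0 0 le_rfl le_rfl
    simp only [add_zero] at this
    linarith
  have hnat : ∀ (n : ℕ) (y : ℝ), 0 ≤ y → F (n * y) = n * F y := by
    intro n y hy
    induction n with
    | zero => simp [h0]
    | succ n ih =>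
      rw [Nat.cast_succ, add_mul, one_mul, hadd _ _ (by positivity) hy, ih]
      ring
  have hF1 : 0 ≤ F 1 := h0 ▸ hmono (by simp) (by simp) zero_le_one
  have hbound : ∀ n : ℕ, n * |F x - x * F 1| ≤ F 1 := by
    intro n
    have hnx : 0 ≤ n * x := by positivity
    have hl := Nat.floor_le hnx
    have hu := (Nat.lt_floor_add_one (n * x)).le
    have h1 := hmono (a := (⌊n * x⌋₊ : ℝ) * 1) (b := n * x) (by simp) hnx (by simpa using hl)
    have h2 := hmono (a := n * x) (b := ((⌊n * x⌋₊ + 1 : ℕ) : ℝ) * 1) hnx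
      (Set.mem_Ici.2 (by positivity)) (by simpa using hu)
    rw [hnat _ _ hx, hnat _ _ zero_le_one] at h1 h2
    push_cast at h2
    rw [← abs_of_nonneg (Nat.cast_nonneg (α := ℝ) n), ← abs_mul, abs_le]
    constructor <;> nlinarith
  by_contra hne
  have hpos : 0 < |F x - x * F 1| := abs_pos.2 (sub_ne_zero.2 hne)
  obtain ⟨n, hn⟩ := exists_nat_gt (F 1 / |F x - x * F 1|)
  rw [div_lt_iff₀ hpos] at hn
  exact absurd (hbound n) (not_le.2 hn)

section DomainOfAttraction

variable {R Q : ℝ → ℝ} {a : ℕ → ℝ}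

lemma one_sub_mul_one_sub_mem_Ico {b s : ℝ} (hb : 0 < b ∧ b < 1) (hs : s ∈ Set.Ico (0 : ℝ) 1) :
    1 - b * (1 - s) ∈ Set.Ico (0 : ℝ) 1 := by
  obtain ⟨hs0, hs1⟩ := hs
  constructor <;> nlinarith [hb.1, hb.2]

/-- The limit of normed convolution powers charges the origin. -/
lemma limit_pos_at_zero
    (hRmid : ∀ s ∈ Set.Ico (0 : ℝ) 1, 2 * R ((1 + s) / 2) ≤ 1 + R s)
    (hR0 : ∀ s ∈ Set.Ico (0 : ℝ) 1, 0 ≤ R s) (hR1 : ∀ s ∈ Set.Ico (0 : ℝ) 1, R s ≤ 1)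
    (ha : ∀ n : ℕ, 0 < a n ∧ a n < 1)
    (hlim : ∀ s ∈ Set.Ico (0 : ℝ) 1,
      Tendsto (fun n : ℕ => (R (1 - a n * (1 - s))) ^ n) atTop (nhds (Q s)))
    (hpos : 0 < Q (1 / 2)) : 0 < Q 0 := by
  have hm : (1 / 2 : ℝ) ∈ Set.Ico (0 : ℝ) 1 := by norm_num
  have hz : (0 : ℝ) ∈ Set.Ico (0 : ℝ) 1 := by norm_num
  have hhalf := hlim _ hm
  have hsmall : Tendsto (fun n : ℕ => (3 / 4 : ℝ) ^ n) atTop (nhds 0) :=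
    tendsto_pow_atTop_nhds_zero_of_lt_one (by norm_num) (by norm_num)
  have hle : Q (1 / 2) ^ 3 ≤ Q 0 := by
    refine le_of_tendsto_of_tendsto (hhalf.pow 3) (hlim 0 hz) ?_
    filter_upwards [hsmall.eventually_lt hhalf hpos] with n hn
    have hx0 := hR0 _ (one_sub_mul_one_sub_mem_Ico (ha n) hm)
    have hx1 := hR1 _ (one_sub_mul_one_sub_mem_Ico (ha n) hm)
    have hx := lt_of_pow_lt_pow_left₀ n hx0 hn
    have hmid := hRmid _ (one_sub_mul_one_sub_mem_Ico (ha n) hz)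
    rw [show (1 + (1 - a n * (1 - 0))) / 2 = 1 - a n * (1 - 1 / 2) by ring] at hmid
    set x := R (1 - a n * (1 - 1 / 2))
    rw [← pow_mul, mul_comm, pow_mul]
    refine pow_le_pow_left₀ (by positivity) ?_ n
    nlinarith [mul_nonneg (sub_nonneg.2 hx1) (show 0 ≤ x ^ 2 + x - 1 by nlinarith)]
  exact (pow_pos hpos 3).trans_le hle

lemma limit_functional_equation
    (hRmono : MonotoneOn R (Set.Ico 0 1))
    (hR0 : ∀ s ∈ Set.Ico (0 : ℝ) 1, 0 ≤ R s)
    (ha : ∀ n : ℕ, 0 < a n ∧ a n < 1)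
    (hlim : ∀ s ∈ Set.Ico (0 : ℝ) 1,
      Tendsto (fun n : ℕ => (R (1 - a n * (1 - s))) ^ n) atTop (nhds (Q s)))
    (hQmono : StrictMonoOn Q (Set.Ico 0 1)) (hQcont : ContinuousOn Q (Set.Ico 0 1))
    (hQ0 : 0 < Q 0) (hQ1 : ∀ s ∈ Set.Ico (0 : ℝ) 1, Q s < 1)
    {c t : ℝ} (hc : c ∈ Set.Ioo (0 : ℝ) 1) (ht : t ∈ Set.Ioc (0 : ℝ) 1) :
    Q (1 - c * t) = Q (1 - t) ^ (Real.log (Q (1 - c)) / Real.log (Q 0)) := by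
  obtain ⟨hc0, hc1⟩ := hc
  have hz : (0 : ℝ) ∈ Set.Ico (0 : ℝ) 1 := by norm_num
  have hmem : ∀ u : ℝ, 0 < u → u ≤ 1 → 1 - u ∈ Set.Ico (0 : ℝ) 1 := fun u h0 h1 =>
    ⟨by linarith, by linarith⟩
  have hamem : ∀ n (u : ℝ), 0 < u → u ≤ 1 → 1 - a n * u ∈ Set.Ico (0 : ℝ) 1 := fun n u h0 h1 =>
    hmem _ (mul_pos (ha n).1 h0) (by nlinarith [(ha n).1, (ha n).2])
  have hlim' : ∀ u : ℝ, 0 < u → u ≤ 1 →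
      Tendsto (fun n : ℕ => (R (1 - a n * u)) ^ n) atTop (nhds (Q (1 - u))) := fun u h0 h1 => by
    simpa using hlim _ (hmem u h0 h1)
  have hlt : ∀ u v : ℝ, 0 < u → u < v → v ≤ 1 → Q (1 - v) < Q (1 - u) := fun u v h0 h h1 =>
    hQmono (hmem v (h0.trans h) h1) (hmem u h0 (h.le.trans h1)) (by linarith)
  have hlogc : Real.log (Q (1 - c)) < 0 := by
    refine Real.log_neg (hQ0.trans ?_) (hQ1 _ (hmem c hc0 hc1.le))
    simpa using hlt c 1 hc0 hc1 le_rfl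
  have hlog0 : Real.log (Q 0) < 0 := Real.log_neg hQ0 (hQ1 _ hz)
  set r := Real.log (Q (1 - c)) / Real.log (Q 0) with hr
  have hrpos : 0 < r := div_pos_of_neg_of_neg hlogc hlog0
  have hQr : Q 0 ^ r = Q (1 - c) := by
    rw [Real.rpow_def_of_pos hQ0, hr, mul_div_cancel₀ _ hlog0.ne, Real.exp_log]
    exact hQ0.trans (by simpa using hlt c 1 hc0 hc1 le_rfl)
  let m : ℕ → ℕ := fun n => ⌈r⁻¹ * n⌉₊
  have hm : Tendsto m atTop atTop :=
    tendsto_nat_ceil_atTop.comp (tendsto_natCast_atTop_atTop.const_mul_atTop (inv_pos.2 hrpos))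
  have hmr : Tendsto (fun n : ℕ => (n : ℝ) / m n) atTop (nhds r) := by
    have h := ((tendsto_nat_ceil_mul_div_atTop (inv_pos.2 hrpos).le).comp
      tendsto_natCast_atTop_atTop).inv₀ (inv_pos.2 hrpos).ne'
    rw [inv_inv] at h
    exact h.congr fun n => by simp [m]
  have hlimm : ∀ u : ℝ, 0 < u → u ≤ 1 →
      Tendsto (fun n : ℕ => (R (1 - a (m n) * u)) ^ n) atTop (nhds (Q (1 - u) ^ r)) := by
    intro u h0 h1
    refine (((hlim' u h0 h1).comp hm).rpow hmr (Or.inr hrpos)).congr' ?_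
    filter_upwards [hm.eventually_ne_atTop 0] with n hn
    simp only [Function.comp]
    rw [← Real.rpow_natCast, ← Real.rpow_mul (hR0 _ (hamem _ u h0 h1)),
      mul_div_cancel₀ _ (Nat.cast_ne_zero.2 hn), Real.rpow_natCast]
  have hlim1 := hlimm 1 one_pos le_rfl
  rw [sub_self, hQr] at hlim1
  have hct : 0 < c * t := mul_pos hc0 ht.1
  have hct1 : c * t < 1 := by nlinarith [ht.2]
  have hcont : ContinuousAt (fun d : ℝ => Q (1 - d * t)) c := by
    refine ContinuousAt.comp (f := fun d : ℝ => 1 - d * t) (g := Q) ?_ (by fun_prop)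
    exact hQcont.continuousAt (Ico_mem_nhds (by linarith) (by linarith))
  apply le_antisymm
  · refine le_of_tendsto (hcont.tendsto.mono_left (nhdsWithin_le_nhds (s := Set.Ioi c))) ?_
    filter_upwards [Ioo_mem_nhdsGT hc1] with d hd
    have hd0 : 0 < d := hc0.trans hd.1
    have hdt1 : d * t ≤ 1 := by nlinarith [hd.2, ht.1, ht.2]
    refine le_of_tendsto_of_tendsto (hlim' (d * t) (mul_pos hd0 ht.1) hdt1)
      (hlimm t ht.1 ht.2) ?_
    filter_upwards [(hlim' d hd0 hd.2.le).eventually_lt hlim1 (hlt c d hc0 hd.1 hd.2.le)] with n hn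
    have h1 := lt_of_pow_lt_pow_left₀ n (hR0 _ (hamem _ 1 one_pos le_rfl)) hn
    have h2 := hRmono.reflect_lt (hamem _ d hd0 hd.2.le) (hamem _ 1 one_pos le_rfl) h1
    have h3 := hamem n _ (mul_pos hd0 ht.1) hdt1
    exact pow_le_pow_left₀ (hR0 _ h3)
      (hRmono h3 (hamem _ t ht.1 ht.2) (by nlinarith [ht.1])) n
  · refine ge_of_tendsto (hcont.tendsto.mono_left (nhdsWithin_le_nhds (s := Set.Iio c))) ?_
    filter_upwards [Ioo_mem_nhdsLT hc0] with d hd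
    have hd1 : d ≤ 1 := (hd.2.trans hc1).le
    have hdt1 : d * t ≤ 1 := by nlinarith [hd.1, ht.1, ht.2]
    refine le_of_tendsto_of_tendsto (hlimm t ht.1 ht.2) (hlim' (d * t) (mul_pos hd.1 ht.1) hdt1) ?_
    filter_upwards [hlim1.eventually_lt (hlim' d hd.1 hd1) (hlt d c hd.1 hd.2 hc1.le)] with n hn
    have h1 := lt_of_pow_lt_pow_left₀ n (hR0 _ (hamem _ d hd.1 hd1)) hn
    have h2 := hRmono.reflect_lt (hamem _ 1 one_pos le_rfl) (hamem _ d hd.1 hd1) h1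
    exact pow_le_pow_left₀ (hR0 _ (hamem _ t ht.1 ht.2))
      (hRmono (hamem _ t ht.1 ht.2) (hamem n _ (mul_pos hd.1 ht.1) hdt1) (by nlinarith [ht.1])) n

end DomainOfAttraction

lemma exists_rpow_of_functional_equation {Q : ℝ → ℝ} (hQmono : StrictMonoOn Q (Set.Ico 0 1))
    (hQ0 : 0 < Q 0) (hQ1 : ∀ s ∈ Set.Ico (0 : ℝ) 1, Q s < 1)
    (hfun : ∀ c ∈ Set.Ioo (0 : ℝ) 1, ∀ t ∈ Set.Ioc (0 : ℝ) 1,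
      Q (1 - c * t) = Q (1 - t) ^ (Real.log (Q (1 - c)) / Real.log (Q 0))) :
    ∃ l : ℝ, 0 < l ∧ ∃ α : ℝ, 0 < α ∧
      ∀ s ∈ Set.Ico (0 : ℝ) 1, Q s = Real.exp (-l * (1 - s) ^ α) := by
  have hz : (0 : ℝ) ∈ Set.Ico (0 : ℝ) 1 := by norm_num
  have hpos : ∀ s ∈ Set.Ico (0 : ℝ) 1, 0 < Q s := fun s hs =>
    hQ0.trans_le (hQmono.monotoneOn hz hs hs.1)
  have hmem : ∀ x : ℝ, 0 ≤ x → 1 - Real.exp (-x) ∈ Set.Ico (0 : ℝ) 1 := fun x hx =>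
    ⟨by simpa using hx, by linarith [Real.exp_pos (-x)]⟩
  have hlog0 : Real.log (Q 0) < 0 := Real.log_neg hQ0 (hQ1 _ hz)
  have hlog : ∀ s ∈ Set.Ico (0 : ℝ) 1, Real.log (Q s) < 0 := fun s hs =>
    Real.log_neg (hpos s hs) (hQ1 s hs)
  let f : ℝ → ℝ := fun x => Real.log (Q (1 - Real.exp (-x))) / Real.log (Q 0)
  have hf : ∀ x, 0 ≤ x → 0 < f x := fun x hx => div_pos_of_neg_of_neg (hlog _ (hmem x hx)) hlog0
  have hf0 : f 0 = 1 := by simp [f, hlog0.ne]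
  have hfanti : StrictAntiOn f (Set.Ici 0) := by
    intro x hx y hy hxy
    refine div_lt_div_of_neg_of_lt hlog0 (Real.log_lt_log (hpos _ (hmem x hx)) ?_)
    refine hQmono (hmem x hx) (hmem y hy) ?_
    have := Real.exp_lt_exp.2 (neg_lt_neg hxy)
    linarith
  have hfmul : ∀ x y, 0 ≤ x → 0 ≤ y → f (x + y) = f x * f y := by
    intro x y hx hy
    rcases hx.eq_or_lt with rfl | hx'
    · simp [hf0]
    have h := hfun (Real.exp (-x)) ⟨Real.exp_pos _, by simpa using hx'⟩
      (Real.exp (-y)) ⟨Real.exp_pos _, by simpa using hy⟩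
    simp only [f]
    rw [neg_add, Real.exp_add, h, Real.log_rpow (hpos _ (hmem y hy))]
    ring
  let F : ℝ → ℝ := fun x => -Real.log (f x)
  have hF : ∀ x, 0 ≤ x → F x = x * F 1 := fun x hx => by
    refine eq_mul_one_of_additive_of_monotoneOn (fun x y hx hy => ?_) (fun x hx y hy hxy => ?_) hx
    · simp only [F]
      rw [hfmul x y hx hy, Real.log_mul (hf x hx).ne' (hf y hy).ne']
      ring
    · exact neg_le_neg (Real.log_le_log (hf y hy) (hfanti.antitoneOn hx hy hxy))
  refine ⟨-Real.log (Q 0), neg_pos.2 hlog0, F 1, ?_, fun s hs => ?_⟩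
  · refine neg_pos.2 (Real.log_neg (hf 1 zero_le_one) ?_)
    calc f 1 < f 0 := hfanti (by simp) (by simp) one_pos
      _ = 1 := hf0
  · have hs1 : 0 < 1 - s := by linarith [hs.2]
    have hx : 0 ≤ -Real.log (1 - s) :=
      neg_nonneg.2 (Real.log_nonpos hs1.le (by linarith [hs.1]))
    have h := hF _ hx
    have hfs : f (-Real.log (1 - s)) = Real.log (Q s) / Real.log (Q 0) := by
      simp [f, Real.exp_log hs1]
    have h2 : Real.log (f (-Real.log (1 - s))) = Real.log (1 - s) * F 1 := by
      simp only [F] at h ⊢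
      linarith
    rw [Real.rpow_def_of_pos hs1, ← h2, Real.exp_log (hf _ hx), hfs, neg_neg,
      mul_div_cancel₀ _ hlog0.ne, Real.exp_log (hpos s hs)]

lemma exponent_le_one {l α b : ℝ} (hb : 0 < b)
    (h : ∀ s ∈ Set.Ico (0 : ℝ) 1, Real.exp (-l * (1 - s) ^ α) ≤ 1 - b * (1 - s)) : α ≤ 1 := by
  by_contra! hα
  have hlim : Tendsto (fun t : ℝ => l * t ^ (α - 1)) (nhdsWithin 0 (Set.Ioi 0)) (nhds 0) := by
    have h1 : ContinuousAt (fun t : ℝ => l * t ^ (α - 1)) 0 :=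
      continuousAt_const.mul (Real.continuousAt_rpow_const _ _ (Or.inr (by linarith)))
    have h2 := h1.tendsto
    rw [Real.zero_rpow (by linarith), mul_zero] at h2
    exact h2.mono_left nhdsWithin_le_nhds
  refine absurd (ge_of_tendsto hlim ?_) (not_le.2 hb)
  filter_upwards [Ioo_mem_nhdsGT (zero_lt_one' ℝ)] with t ht
  have h1 := h (1 - t) ⟨by linarith [ht.2], by linarith [ht.1]⟩
  rw [sub_sub_cancel] at h1
  have h2 := Real.add_one_le_exp (-l * t ^ α)
  rw [Real.rpow_sub_one ht.1.ne', ← mul_div_assoc, le_div_iff₀ ht.1]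
  linarith

/-- In the discrete case, discrete stable laws and they alone possess a domain of
attraction: a non-degenerate pmf p on ℕ with pgf Q is the limit, in the sense
(R(1 - aₙ(1 - s)))ⁿ → Q(s) on [0,1), of normed n-fold convolution powers of some
non-degenerate pmf with pgf R iff Q(s) = exp(-λ(1-s)^α) with λ > 0, 0 < α ≤ 1. -/
theorem stmt_11 (p : ℕ → ℝ) (hp : IsPMF p) (hnd : ¬ IsDegenerate p)
    (Q : ℝ → ℝ)
    (hQ : ∀ s : ℝ, s ∈ Set.Ico (0 : ℝ) 1 → HasSum (fun n : ℕ => p n * s ^ n) (Q s)) :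
    (∃ (q : ℕ → ℝ) (R : ℝ → ℝ) (a : ℕ → ℝ),
      IsPMF q ∧ ¬ IsDegenerate q ∧
      (∀ s : ℝ, s ∈ Set.Ico (0 : ℝ) 1 → HasSum (fun n : ℕ => q n * s ^ n) (R s)) ∧
      (∀ n : ℕ, 0 < a n ∧ a n < 1) ∧
      (∀ s : ℝ, s ∈ Set.Ico (0 : ℝ) 1 →
        Tendsto (fun n : ℕ => (R (1 - a n * (1 - s))) ^ n) atTop (nhds (Q s)))) ↔
    (∃ l : ℝ, 0 < l ∧ ∃ α : ℝ, 0 < α ∧ α ≤ 1 ∧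
      ∀ s : ℝ, s ∈ Set.Ico (0 : ℝ) 1 → Q s = Real.exp (-l * (1 - s) ^ α)) := by
  constructor
  · rintro ⟨q, R, a, hq, hqnd, hR, ha, hlim⟩
    obtain ⟨b, hb, hQb⟩ := exists_pgf_le_one_sub_mul hp hnd hQ
    obtain ⟨b', hb', hRb⟩ := exists_pgf_le_one_sub_mul hq hqnd hR
    have hQ1 : ∀ s ∈ Set.Ico (0 : ℝ) 1, Q s < 1 := fun s hs => by
      nlinarith [hQb s hs, hs.2, mul_pos hb (sub_pos.2 hs.2)]
    have hR1 : ∀ s ∈ Set.Ico (0 : ℝ) 1, R s ≤ 1 := fun s hs => by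
      nlinarith [hRb s hs, hs.2, mul_pos hb' (sub_pos.2 hs.2)]
    have hR0 : ∀ s ∈ Set.Ico (0 : ℝ) 1, 0 ≤ R s := fun s hs => pgf_nonneg hq hR hs
    have hmono := pgf_strictMonoOn hp hnd hQ
    have hQ0 : 0 < Q 0 := limit_pos_at_zero (fun s hs => two_mul_pgf_midpoint_le hq hR hs)
      hR0 hR1 ha hlim (pgf_pos hp hnd hQ (by norm_num))
    obtain ⟨l, hl, α, hα, h⟩ := exists_rpow_of_functional_equation hmono hQ0 hQ1
      fun c hc t ht => limit_functional_equation (pgf_monotoneOn hq hR) hR0 ha hlim hmono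
        (pgf_continuousOn hp hQ) hQ0 hQ1 hc ht
    exact ⟨l, hl, α, hα, exponent_le_one hb fun s hs => h s hs ▸ hQb s hs, h⟩
  · rintro ⟨l, hl, α, hα, -, h⟩
    let a : ℕ → ℝ := fun n => if 2 ≤ n then (n : ℝ) ^ (-α⁻¹) else 1 / 2
    have ha : ∀ n, 0 < a n ∧ a n < 1 := by
      intro n
      by_cases hn : 2 ≤ n
      · simp only [a, if_pos hn]
        have hn1 : (1 : ℝ) < n := by exact_mod_cast hn
        exact ⟨Real.rpow_pos_of_pos (by linarith) _,
          Real.rpow_lt_one_of_one_lt_of_neg hn1 (neg_neg_of_pos (inv_pos.2 hα))⟩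
      · simp only [a, if_neg hn]
        norm_num
    refine ⟨p, Q, a, hp, hnd, hQ, ha, fun s hs => ?_⟩
    refine tendsto_const_nhds.congr' ?_
    filter_upwards [eventually_ge_atTop 2] with n hn
    have hn0 : (0 : ℝ) < n := by exact_mod_cast (by omega : 0 < n)
    have han : a n ^ α = (n : ℝ)⁻¹ := by
      simp only [a, if_pos hn]
      rw [← Real.rpow_mul hn0.le, neg_mul, inv_mul_cancel₀ hα.ne', Real.rpow_neg_one]
    rw [h s hs, h _ (one_sub_mul_one_sub_mem_Ico (ha n) hs), sub_sub_cancel,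
      Real.mul_rpow (ha n).1.le (by linarith [hs.2]), han, ← Real.exp_nat_mul]
    congr 1
    field_simp
end

section
/- Let U be a nonnegative random variable with law μ on [0, ∞) and Laplace transform φ(s) = ∫ e^{−sx} dμ(x). Fix integers j ≥ 0 and k ≥ 1, and for each θ > 0 let N_θ be a nonnegative integer valued random variable whose probability mass function p_θ has probability generating function ∑_{n≥0} p_θ(n) s^n = s^j φ((1 − s^k)/θ) for 0 < s < 1. Then θ·N_θ converges in distribution to k·U as θ → 0⁺; equivalently, for every s > 0, ∑_{n≥0} p_θ(n) e^{−sθn} → φ(ks) as θ → 0⁺. -/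
open MeasureTheory Filter

/-- The Laplace transform of a probability measure on `[0, ∞)` is continuous along countably generated
filters of nonnegative arguments. -/
theorem tendsto_laplace {ι : Type*} {l : Filter ι} [l.IsCountablyGenerated]
    (μ : Measure ℝ) [IsProbabilityMeasure μ] (hpos : μ (Set.Ici (0 : ℝ)) = 1)
    {u : ι → ℝ} {a : ℝ} (hu : ∀ᶠ i in l, 0 ≤ u i) (ha : Tendsto u l (nhds a)) :
    Tendsto (fun i => ∫ x, Real.exp (-u i * x) ∂μ) l (nhds (∫ x, Real.exp (-a * x) ∂μ)) := by
  have hx : ∀ᵐ x ∂μ, x ∈ Set.Ici (0 : ℝ) := (mem_ae_iff_prob_eq_one measurableSet_Ici).2 hpos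
  refine tendsto_integral_filter_of_dominated_convergence (fun _ => (1 : ℝ)) ?_ ?_
    (integrable_const _) ?_
  · exact Eventually.of_forall fun i => by fun_prop
  · filter_upwards [hu] with i hi
    filter_upwards [hx] with x hx
    rw [Real.norm_eq_abs, Real.abs_exp, Real.exp_le_one_iff]
    exact mul_nonpos_of_nonpos_of_nonneg (neg_nonpos.2 hi) hx
  · exact Eventually.of_forall fun x => (Real.continuous_exp.tendsto _).comp (ha.neg.mul_const x)

/-- The derivative of `θ ↦ 1 - exp (-cθ)` at `0` from the right is `c`. -/
theorem tendsto_one_sub_exp_div (c : ℝ) :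
    Tendsto (fun θ : ℝ => (1 - Real.exp (-(c * θ))) / θ) (nhdsWithin 0 (Set.Ioi 0)) (nhds c) := by
  have h : HasDerivAt (fun θ : ℝ => 1 - Real.exp (-(c * θ))) c 0 := by
    have h' := (((hasDerivAt_id (0 : ℝ)).const_mul c).neg.exp).const_sub 1
    simpa using h'
  have h' := h.tendsto_slope_zero_right
  simpa [div_eq_inv_mul] using h'

/-- If N_θ has pgf s^j φ((1 - s^k)/θ), where φ is the Laplace transform of a law μ on
[0, ∞), then θ·N_θ converges in distribution to k·U as θ → 0⁺, U having law μ: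
the Laplace transforms ∑ p_θ(n) e^{-sθn} converge to φ(ks) for every s > 0. -/
theorem stmt_14 (μ : Measure ℝ) [IsProbabilityMeasure μ] (hpos : μ (Set.Ici (0 : ℝ)) = 1)
    (φ : ℝ → ℝ) (hφ : ∀ s : ℝ, 0 ≤ s → φ s = ∫ x, Real.exp (-s * x) ∂μ)
    (j k : ℕ) (hk : 1 ≤ k)
    (p : ℝ → ℕ → ℝ)
    (hp : ∀ θ : ℝ, 0 < θ → IsPMF (p θ))
    (hgen : ∀ θ : ℝ, 0 < θ → ∀ s : ℝ, s ∈ Set.Ioo (0 : ℝ) 1 →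
      HasSum (fun n : ℕ => p θ n * s ^ n) (s ^ j * φ ((1 - s ^ k) / θ))) :
    ∀ s : ℝ, 0 < s →
      Tendsto (fun θ : ℝ => ∑' n : ℕ, p θ n * Real.exp (-(s * θ * n)))
        (nhdsWithin 0 (Set.Ioi 0)) (nhds (φ (k * s))) := by
  intro s hs
  have hc : 0 ≤ (k : ℝ) * s := by positivity
  have hlim := tendsto_one_sub_exp_div (k * s)
  have hnonneg : ∀ θ : ℝ, 0 < θ → 0 ≤ (1 - Real.exp (-(k * s * θ))) / θ := fun θ hθ =>
    div_nonneg (sub_nonneg.2 (Real.exp_le_one_iff.2 (neg_nonpos.2 (mul_nonneg hc hθ.le)))) hθ.le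
  have hφlim := tendsto_laplace (l := nhdsWithin 0 (Set.Ioi (0 : ℝ))) μ hpos
    (eventually_mem_nhdsWithin.mono hnonneg) hlim
  have hexp : Tendsto (fun θ : ℝ => Real.exp (-(s * θ)) ^ j)
      (nhdsWithin 0 (Set.Ioi 0)) (nhds 1) := by
    have h : Continuous fun θ : ℝ => Real.exp (-(s * θ)) ^ j := by fun_prop
    simpa using (h.tendsto 0).mono_left nhdsWithin_le_nhds
  have h := hexp.mul hφlim
  rw [one_mul, ← hφ _ hc] at h
  refine h.congr' ?_
  filter_upwards [self_mem_nhdsWithin] with θ hθ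
  have hθ' : 0 < θ := hθ
  have hlt : Real.exp (-(s * θ)) < 1 := Real.exp_lt_one_iff.2 (neg_lt_zero.2 (mul_pos hs hθ'))
  have hsum := (hgen θ hθ' _ ⟨Real.exp_pos _, hlt⟩).tsum_eq
  have hpow : ∀ n : ℕ, Real.exp (-(s * θ)) ^ n = Real.exp (-(s * θ * n)) := fun n => by
    rw [← Real.exp_nat_mul]
    ring_nf
  have hk' : Real.exp (-(s * θ)) ^ k = Real.exp (-(k * s * θ)) := by
    rw [hpow]
    ring_nf
  rw [hk', hφ _ (hnonneg θ hθ')] at hsum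
  simp only [hpow] at hsum ⊢
  exact hsum.symm
end

section
/- A φ-mixture of a strictly stable law is self-decomposable (belongs to class L) if φ is the Laplace transform of a self-decomposable law. Precisely: let μ be a probability measure on [0, ∞) with Laplace transform φ(s) = ∫ e^{−sx} dμ(x), and suppose μ is self-decomposable, i.e., for every c with 0 < c < 1 there exists a probability measure ν_c on [0, ∞) whose Laplace transform equals s ↦ φ(s)/φ(cs). Then for every α with 0 < α ≤ 1, the function ψ(s) = φ(s^α) is the Laplace transform of a probability measure on [0, ∞) which is itself self-decomposable: for every c with 0 < c < 1 there exists a probability measure ρ_c on [0, ∞) whose Laplace transform equals s ↦ ψ(s)/ψ(cs). -/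
open MeasureTheory

/-- `f` is, on `(0, ∞)`, the Laplace transform of a probability measure on `[0, ∞]`, the latter
being identified with the unit interval through `x ↦ exp (-x)`. -/
def IsExtendedLaplace (f : ℝ → ℝ) : Prop :=
  ∃ P : ProbabilityMeasure unitInterval,
    ∀ s : ℝ, 0 < s → ∫ y, (y : ℝ) ^ s ∂(P : Measure unitInterval) = f s

namespace IsExtendedLaplace

open Filter Topology

lemma continuous_rpow {s : ℝ} (hs : 0 < s) :
    Continuous fun y : unitInterval ↦ (y : ℝ) ^ s :=
  continuous_subtype_val.rpow_const fun _ ↦ Or.inr hs.le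

lemma one : IsExtendedLaplace fun _ ↦ 1 := by
  refine ⟨⟨Measure.dirac 1, inferInstance⟩, fun s _ ↦ ?_⟩
  simp

lemma mul {f g : ℝ → ℝ} (hf : IsExtendedLaplace f) (hg : IsExtendedLaplace g) :
    IsExtendedLaplace fun s ↦ f s * g s := by
  obtain ⟨P, hP⟩ := hf
  obtain ⟨Q, hQ⟩ := hg
  have hm : Measurable fun p : unitInterval × unitInterval ↦ p.1 * p.2 :=
    continuous_mul.measurable
  refine ⟨⟨((P : Measure unitInterval).prod Q).map fun p ↦ p.1 * p.2,
    Measure.isProbabilityMeasure_map hm.aemeasurable⟩, fun s hs ↦ ?_⟩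
  rw [ProbabilityMeasure.coe_mk, integral_map hm.aemeasurable
    (continuous_rpow hs).aestronglyMeasurable, show (fun s ↦ f s * g s) s = f s * g s from rfl,
    ← hP s hs, ← hQ s hs, ← integral_prod_mul]
  congr with p
  exact Real.mul_rpow p.1.2.1 p.2.2.1

lemma pow {f : ℝ → ℝ} (hf : IsExtendedLaplace f) (n : ℕ) :
    IsExtendedLaplace fun s ↦ f s ^ n := by
  induction n with
  | zero => simpa using one
  | succ n ih => simpa only [pow_succ] using ih.mul hf

lemma comp_mul_left {f : ℝ → ℝ} (hf : IsExtendedLaplace f) {c : ℝ} (hc : 0 < c) :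
    IsExtendedLaplace fun s ↦ f (c * s) := by
  obtain ⟨P, hP⟩ := hf
  let g : unitInterval → unitInterval := fun y ↦
    ⟨(y : ℝ) ^ c, Real.rpow_nonneg y.2.1 c, Real.rpow_le_one y.2.1 y.2.2 hc.le⟩
  have hg : Measurable g := ((continuous_rpow hc).subtype_mk _).measurable
  refine ⟨⟨(P : Measure unitInterval).map g,
    Measure.isProbabilityMeasure_map hg.aemeasurable⟩, fun s hs ↦ ?_⟩
  rw [ProbabilityMeasure.coe_mk, integral_map hg.aemeasurable
    (continuous_rpow hs).aestronglyMeasurable, show (fun s ↦ f (c * s)) s = f (c * s) from rfl,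
    ← hP _ (mul_pos hc hs)]
  congr with y
  exact (Real.rpow_mul y.2.1 c s).symm

lemma of_tendsto {F : ℕ → ℝ → ℝ} {f : ℝ → ℝ} (hF : ∀ n, IsExtendedLaplace (F n))
    (hlim : ∀ s, 0 < s → Tendsto (fun n ↦ F n s) atTop (𝓝 (f s))) : IsExtendedLaplace f := by
  choose P hP using hF
  obtain ⟨Q, hQ⟩ := exists_clusterPt_of_compactSpace (map P atTop)
  refine ⟨Q, fun s hs ↦ ?_⟩
  have hcont : Continuous fun R : ProbabilityMeasure unitInterval ↦
      ∫ y, (y : ℝ) ^ s ∂(R : Measure unitInterval) :=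
    ProbabilityMeasure.continuous_integral_continuousMap
      (⟨_, continuous_rpow hs⟩ : C(unitInterval, ℝ))
  have h := MapClusterPt.continuousAt_comp hcont.continuousAt hQ
  have h' : Tendsto ((fun R : ProbabilityMeasure unitInterval ↦
      ∫ y, (y : ℝ) ^ s ∂(R : Measure unitInterval)) ∘ P) atTop (𝓝 (f s)) :=
    (hlim s hs).congr fun n ↦ (hP n s hs).symm
  exact eq_of_nhds_neBot (h.clusterPt.neBot.mono (inf_le_inf_left _ h'))

lemma sum_mul_exp {ι : Type*} (S : Finset ι) (p x : ι → ℝ) (hp : ∀ i ∈ S, 0 ≤ p i)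
    (hp1 : ∑ i ∈ S, p i ≤ 1) (hx : ∀ i, 0 ≤ x i) :
    IsExtendedLaplace fun s ↦ ∑ i ∈ S, p i * Real.exp (-s * x i) := by
  let e : ι → unitInterval := fun i ↦
    ⟨Real.exp (-x i), (Real.exp_pos _).le, Real.exp_le_one_iff.2 (neg_nonpos.2 (hx i))⟩
  let m : Measure unitInterval := (∑ i ∈ S, ENNReal.ofReal (p i) • Measure.dirac (e i)) +
    ENNReal.ofReal (1 - ∑ i ∈ S, p i) • Measure.dirac 0
  have hm : IsProbabilityMeasure m := by
    constructor
    simp only [m, Measure.add_apply, Measure.finsetSum_apply, Measure.smul_apply,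
      measure_univ, smul_eq_mul, mul_one]
    rw [← ENNReal.ofReal_sum_of_nonneg hp, ← ENNReal.ofReal_add (Finset.sum_nonneg hp)
      (sub_nonneg.2 hp1)]
    simp
  refine ⟨⟨m, hm⟩, fun s hs ↦ ?_⟩
  have hi (c : ℝ) (y : unitInterval) : Integrable (fun y : unitInterval ↦ (y : ℝ) ^ s)
      (ENNReal.ofReal c • Measure.dirac y) :=
    (integrable_dirac (by simp)).smul_measure ENNReal.ofReal_ne_top
  rw [ProbabilityMeasure.coe_mk, integral_add_measure
    (integrable_finsetSum_measure.2 fun i _ ↦ hi _ _) (hi _ _),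
    integral_finsetSum_measure fun i _ ↦ hi _ _]
  simp only [integral_smul_measure, integral_dirac, smul_eq_mul]
  rw [show (((0 : unitInterval) : ℝ)) ^ s = 0 from Real.zero_rpow hs.ne', mul_zero, add_zero]
  refine Finset.sum_congr rfl fun i hi ↦ ?_
  rw [ENNReal.toReal_ofReal (hp i hi), ← Real.exp_mul, neg_mul_comm, mul_comm (x i), neg_mul_comm]

/-- If `f → 1` at `0`, then the measure has no mass at infinity. -/
lemma exists_measure {f : ℝ → ℝ} (hf : IsExtendedLaplace f) (hf0 : Tendsto f (𝓝[>] 0) (𝓝 1)) :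
    ∃ σ : Measure ℝ, IsProbabilityMeasure σ ∧ σ (Set.Ici (0 : ℝ)) = 1 ∧
      ∀ s : ℝ, 0 < s → ∫ x, Real.exp (-s * x) ∂σ = f s := by
  obtain ⟨P, hP⟩ := hf
  let u : ℕ → ℝ := fun n ↦ 1 / ((n : ℝ) + 1)
  have hu (n : ℕ) : 0 < u n := Nat.one_div_pos_of_nat
  have hu0 : Tendsto u atTop (𝓝 0) := tendsto_one_div_add_atTop_nhds_zero_nat
  have hu0' : Tendsto u atTop (𝓝[>] 0) :=
    tendsto_nhdsWithin_iff.2 ⟨hu0, .of_forall hu⟩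
  have hlim : Tendsto (fun n ↦ ∫ y : unitInterval, (y : ℝ) ^ u n ∂(P : Measure unitInterval)) atTop
      (𝓝 (∫ y, ({0}ᶜ : Set unitInterval).indicator (fun _ ↦ (1 : ℝ)) y
        ∂(P : Measure unitInterval))) := by
    refine tendsto_integral_of_dominated_convergence (fun _ ↦ 1)
      (fun n ↦ (continuous_rpow (hu n)).aestronglyMeasurable) (integrable_const _)
      (fun n ↦ .of_forall fun y ↦ ?_) (.of_forall fun y ↦ ?_)
    · rw [Real.norm_of_nonneg (Real.rpow_nonneg y.2.1 _)]
      exact Real.rpow_le_one y.2.1 y.2.2 (hu n).le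
    · by_cases hy : y = 0
      · subst hy
        simp [Real.zero_rpow (hu _).ne']
      · have hy' : (y : ℝ) ≠ 0 := fun h ↦ hy (Subtype.ext h)
        simpa [hy] using tendsto_const_nhds.rpow hu0 (Or.inl hy')
  have hone := tendsto_nhds_unique hlim
    ((hf0.comp hu0').congr fun n ↦ (hP _ (hu n)).symm)
  rw [integral_indicator_const _ (measurableSet_singleton _).compl, smul_eq_mul, mul_one] at hone
  have hne : ∀ᵐ y ∂(P : Measure unitInterval), y ≠ 0 := by
    have : (P : Measure unitInterval) ({0}ᶜ : Set unitInterval) = 1 := by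
      rw [← ENNReal.toReal_eq_one_iff]; exact hone
    rw [ae_iff]
    rw [prob_compl_eq_one_iff (measurableSet_singleton _)] at this
    simpa using this
  have hm : Measurable fun y : unitInterval ↦ -Real.log (y : ℝ) := by fun_prop
  have hmσ := Measure.isProbabilityMeasure_map (μ := (P : Measure unitInterval)) hm.aemeasurable
  refine ⟨(P : Measure unitInterval).map fun y : unitInterval ↦ -Real.log (y : ℝ), hmσ, ?_,
    fun s hs ↦ ?_⟩
  · rw [Measure.map_apply hm measurableSet_Ici, Set.eq_univ_of_forall (s := _ ⁻¹' _), measure_univ]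
    exact fun y ↦ neg_nonneg.2 (Real.log_nonpos y.2.1 y.2.2)
  · rw [integral_map hm.aemeasurable (by fun_prop), ← hP s hs]
    refine integral_congr_ae ?_
    filter_upwards [hne] with y hy
    have hy' : 0 < (y : ℝ) := y.2.1.lt_of_ne fun h ↦ hy (Subtype.ext h.symm)
    rw [Real.rpow_def_of_pos hy']
    congr 1
    ring

end IsExtendedLaplace

section Sibuya

open Filter Topology

lemma neg_one_pow_mul_choose_succ_nonneg {α : ℝ} (hα0 : 0 ≤ α) (hα1 : α ≤ 1) (k : ℕ) :
    0 ≤ (-1) ^ k * Ring.choose α (k + 1) := by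
  induction k with
  | zero => simpa using hα0
  | succ k ih =>
    have h := Ring.choose_smul_choose α (Nat.le_succ (k + 1))
    simp only [Nat.succ_eq_add_one, Nat.choose_succ_self_right, nsmul_eq_mul,
      add_tsub_cancel_left, Ring.choose_one_right] at h
    push_cast at h
    have h' : ((k : ℝ) + 1 + 1) * ((-1) ^ (k + 1) * Ring.choose α (k + 1 + 1)) =
        ((-1) ^ k * Ring.choose α (k + 1)) * (k + 1 - α) := by
      rw [pow_succ]
      linear_combination (-(-1) ^ k) * h
    refine nonneg_of_mul_nonneg_right (h' ▸ mul_nonneg ih ?_) (by positivity)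
    have : (0 : ℝ) ≤ k := k.cast_nonneg
    linarith

lemma hasSum_one_sub_one_sub_rpow (α : ℝ) {z : ℝ} (hz0 : 0 ≤ z) (hz1 : z < 1) :
    HasSum (fun k : ℕ ↦ (-1) ^ k * Ring.choose α (k + 1) * z ^ (k + 1)) (1 - (1 - z) ^ α) := by
  have h := (Real.one_add_rpow_hasFPowerSeriesOnBall_zero (a := α)).hasSum (y := -z)
    (by simpa [enorm_eq_nnnorm, ← NNReal.coe_lt_coe, abs_of_nonneg hz0] using hz1)
  rw [← hasSum_nat_add_iff' 1] at h
  have h := h.neg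
  simp only [binomialSeries_apply, List.ofFn_const, List.prod_replicate, Finset.sum_range_one,
    Ring.choose_zero_right, smul_eq_mul, pow_zero, mul_one, neg_sub,
    ← sub_eq_add_neg, zero_sub] at h
  refine h.congr_fun fun k ↦ ?_
  rw [neg_pow z, pow_succ]
  ring

/-- The Laplace transform of the Sibuya distribution. -/
lemma isExtendedLaplace_sibuya {α : ℝ} (hα0 : 0 < α) (hα1 : α ≤ 1) :
    IsExtendedLaplace fun s ↦ 1 - (1 - Real.exp (-s)) ^ α := by
  let p : ℕ → ℝ := fun k ↦ (-1) ^ k * Ring.choose α (k + 1)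
  have hp (k : ℕ) : 0 ≤ p k := neg_one_pow_mul_choose_succ_nonneg hα0.le hα1 k
  have hp1 (N : ℕ) : ∑ k ∈ Finset.range N, p k ≤ 1 := by
    have hlim : Tendsto (fun z : ℝ ↦ ∑ k ∈ Finset.range N, p k * z ^ (k + 1)) (𝓝[<] 1)
        (𝓝 (∑ k ∈ Finset.range N, p k)) := by
      have : Continuous fun z : ℝ ↦ ∑ k ∈ Finset.range N, p k * z ^ (k + 1) := by fun_prop
      simpa using (this.tendsto 1).mono_left nhdsWithin_le_nhds
    refine le_of_tendsto hlim ?_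
    filter_upwards [Ioo_mem_nhdsLT (zero_lt_one' ℝ)] with z hz
    calc ∑ k ∈ Finset.range N, p k * z ^ (k + 1) ≤ 1 - (1 - z) ^ α :=
          sum_le_hasSum _ (fun k _ ↦ mul_nonneg (hp k) (pow_nonneg hz.1.le _))
            (hasSum_one_sub_one_sub_rpow α hz.1.le hz.2)
      _ ≤ 1 := sub_le_self _ (Real.rpow_nonneg (sub_nonneg.2 hz.2.le) _)
  refine IsExtendedLaplace.of_tendsto (fun N ↦ IsExtendedLaplace.sum_mul_exp (Finset.range N) p
    (fun k ↦ (k : ℝ) + 1) (fun k _ ↦ hp k) (hp1 N) fun k ↦ by positivity) fun s hs ↦ ?_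
  have h := (hasSum_one_sub_one_sub_rpow α (Real.exp_pos (-s)).le
    (Real.exp_lt_one_iff.2 (neg_lt_zero.2 hs))).tendsto_sum_nat
  refine h.congr fun N ↦ Finset.sum_congr rfl fun k _ ↦ ?_
  rw [← Real.exp_nat_mul, mul_comm (-s)]
  push_cast
  rfl

lemma tendsto_sibuya_pow {α : ℝ} (hα0 : 0 < α) (s : ℝ) (hs : 0 < s) :
    Tendsto (fun n : ℕ ↦
      (1 - (1 - Real.exp (-(((n : ℝ) + 1) ^ (-α⁻¹) * s))) ^ α) ^ (n + 1)) atTop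
      (𝓝 (Real.exp (-s ^ α))) := by
  have hderiv : Tendsto (fun h : ℝ ↦ h⁻¹ * (1 - Real.exp (-(h * s)))) (𝓝[>] 0) (𝓝 s) := by
    have h : HasDerivAt (fun h : ℝ ↦ 1 - Real.exp (-(h * s))) s 0 := by
      have := (((hasDerivAt_id (0 : ℝ)).mul_const s).neg.exp).const_sub 1
      simpa using this
    have h := h.tendsto_slope_zero_right
    simpa using h
  have hpow : Tendsto (fun x : ℝ ↦ x ^ (-α⁻¹)) atTop (𝓝[>] 0) :=
    tendsto_nhdsWithin_iff.2 ⟨tendsto_rpow_neg_atTop (inv_pos.2 hα0), by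
      filter_upwards [eventually_gt_atTop 0] with x hx using Real.rpow_pos_of_pos hx _⟩
  have hmain : Tendsto (fun x : ℝ ↦ x * -(1 - Real.exp (-(x ^ (-α⁻¹) * s))) ^ α) atTop
      (𝓝 (-s ^ α)) := by
    refine (((hderiv.comp hpow).rpow_const (Or.inr hα0.le)).neg).congr' ?_
    filter_upwards [eventually_gt_atTop 0] with x hx
    have h0 : 0 ≤ 1 - Real.exp (-(x ^ (-α⁻¹) * s)) := by
      rw [sub_nonneg, Real.exp_le_one_iff, neg_nonpos]
      positivity
    rw [Function.comp_apply, Real.mul_rpow (by positivity) h0, ← Real.rpow_neg hx.le, neg_neg,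
      ← Real.rpow_mul hx.le, inv_mul_cancel₀ hα0.ne', Real.rpow_one, mul_neg]
  have h := (Real.tendsto_one_add_rpow_exp_of_tendsto hmain).comp
    (tendsto_atTop_add_const_right _ (1 : ℝ) tendsto_natCast_atTop_atTop)
  refine h.congr fun n ↦ ?_
  rw [Function.comp_apply, ← Real.rpow_natCast, ← sub_eq_add_neg]
  push_cast
  rfl

end Sibuya

open Filter Topology in
/-- Existence of the strictly stable law of index `α` on `[0, ∞)`. -/
theorem exists_positive_stable_measure {α : ℝ} (hα0 : 0 < α) (hα1 : α ≤ 1) :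
    ∃ σ : Measure ℝ, IsProbabilityMeasure σ ∧ σ (Set.Ici (0 : ℝ)) = 1 ∧
      ∀ s : ℝ, 0 ≤ s → ∫ x, Real.exp (-s * x) ∂σ = Real.exp (-s ^ α) := by
  have h : IsExtendedLaplace fun s ↦ Real.exp (-s ^ α) :=
    IsExtendedLaplace.of_tendsto (fun n ↦ ((isExtendedLaplace_sibuya hα0 hα1).comp_mul_left
      (Real.rpow_pos_of_pos n.cast_add_one_pos (-α⁻¹))).pow (n + 1)) (tendsto_sibuya_pow hα0)
  have hcont : Continuous fun s : ℝ ↦ Real.exp (-s ^ α) :=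
    Real.continuous_exp.comp (continuous_id.rpow_const fun _ ↦ Or.inr hα0.le).neg
  obtain ⟨σ, hσ, hσ0, hσs⟩ := h.exists_measure (by
    simpa [Real.zero_rpow hα0.ne'] using (hcont.tendsto 0).mono_left nhdsWithin_le_nhds)
  refine ⟨σ, hσ, hσ0, fun s hs ↦ ?_⟩
  obtain rfl | hs := hs.eq_or_lt
  · simp [Real.zero_rpow hα0.ne']
  · exact hσs s hs

/-- Existence of the mixture of strictly stable laws of index `α` directed by `μ`. -/
theorem exists_stable_mixture {α : ℝ} (hα0 : 0 < α) (hα1 : α ≤ 1) (μ : Measure ℝ)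
    [IsProbabilityMeasure μ] (hμ : μ (Set.Ici (0 : ℝ)) = 1) :
    ∃ ξ : Measure ℝ, IsProbabilityMeasure ξ ∧ ξ (Set.Ici (0 : ℝ)) = 1 ∧
      ∀ s : ℝ, 0 ≤ s → ∫ x, Real.exp (-s * x) ∂ξ = ∫ x, Real.exp (-s ^ α * x) ∂μ := by
  obtain ⟨σ, hσ, hσ0, hσs⟩ := exists_positive_stable_measure hα0 hα1
  have hμ' : ∀ᵐ x ∂μ, 0 ≤ x := (mem_ae_iff_prob_eq_one measurableSet_Ici).2 hμ
  have hσ' : ∀ᵐ x ∂σ, 0 ≤ x := (mem_ae_iff_prob_eq_one measurableSet_Ici).2 hσ0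
  have hm : Measurable fun p : ℝ × ℝ ↦ p.1 ^ α⁻¹ * p.2 := by fun_prop
  have hnonneg : ∀ᵐ p ∂μ.prod σ, 0 ≤ p.1 ^ α⁻¹ * p.2 := by
    filter_upwards [Measure.quasiMeasurePreserving_fst.ae hμ',
      Measure.quasiMeasurePreserving_snd.ae hσ'] with p h₁ h₂
    exact mul_nonneg (Real.rpow_nonneg h₁ _) h₂
  have hξ := Measure.isProbabilityMeasure_map (μ := μ.prod σ) hm.aemeasurable
  refine ⟨_, hξ, ?_, fun s hs ↦ ?_⟩
  · rw [Measure.map_apply hm measurableSet_Ici]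
    exact (mem_ae_iff_prob_eq_one (hm measurableSet_Ici)).1 hnonneg
  · rw [integral_map hm.aemeasurable (by fun_prop), integral_prod]
    · refine integral_congr_ae ?_
      filter_upwards [hμ'] with x hx
      have hx' : 0 ≤ x ^ α⁻¹ := Real.rpow_nonneg hx _
      have h := hσs (s * x ^ α⁻¹) (mul_nonneg hs hx')
      rw [Real.mul_rpow hs hx', ← Real.rpow_mul hx, inv_mul_cancel₀ hα0.ne', Real.rpow_one] at h
      rw [neg_mul, ← h]
      congr with y
      ring_nf
    · refine Integrable.of_bound (by fun_prop) 1 ?_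
      filter_upwards [hnonneg] with p hp
      rw [Real.norm_of_nonneg (Real.exp_pos _).le, Real.exp_le_one_iff, neg_mul, neg_nonpos]
      exact mul_nonneg hs hp

/-- A φ-mixture of a strictly stable law is self-decomposable if φ is the Laplace
transform of a self-decomposable law: if μ on [0, ∞) with Laplace transform φ is
self-decomposable, then for 0 < α ≤ 1 the function s ↦ φ(s^α) is the Laplace transform
of a probability measure on [0, ∞) which is itself self-decomposable. -/
theorem stmt_15 (μ : Measure ℝ) [IsProbabilityMeasure μ] (hpos : μ (Set.Ici (0 : ℝ)) = 1)
    (φ : ℝ → ℝ) (hφ : ∀ s : ℝ, 0 ≤ s → φ s = ∫ x, Real.exp (-s * x) ∂μ)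
    (hSD : ∀ c : ℝ, c ∈ Set.Ioo (0 : ℝ) 1 →
      ∃ ν : Measure ℝ, IsProbabilityMeasure ν ∧ ν (Set.Ici (0 : ℝ)) = 1 ∧
        ∀ s : ℝ, 0 ≤ s → (∫ x, Real.exp (-s * x) ∂ν) = φ s / φ (c * s))
    (α : ℝ) (hα0 : 0 < α) (hα1 : α ≤ 1) :
    ∃ ξ : Measure ℝ, IsProbabilityMeasure ξ ∧ ξ (Set.Ici (0 : ℝ)) = 1 ∧
      (∀ s : ℝ, 0 ≤ s → (∫ x, Real.exp (-s * x) ∂ξ) = φ (s ^ α)) ∧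
      (∀ c : ℝ, c ∈ Set.Ioo (0 : ℝ) 1 →
        ∃ ρ : Measure ℝ, IsProbabilityMeasure ρ ∧ ρ (Set.Ici (0 : ℝ)) = 1 ∧
          ∀ s : ℝ, 0 ≤ s →
            (∫ x, Real.exp (-s * x) ∂ρ) = φ (s ^ α) / φ ((c * s) ^ α)) := by
  obtain ⟨ξ, hξ, hξ0, hξs⟩ := exists_stable_mixture hα0 hα1 μ hpos
  refine ⟨ξ, hξ, hξ0, fun s hs ↦ ?_, fun c hc ↦ ?_⟩
  · rw [hξs s hs, hφ _ (Real.rpow_nonneg hs α)]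
  · obtain ⟨ν, hν, hν0, hνs⟩ :=
      hSD (c ^ α) ⟨Real.rpow_pos_of_pos hc.1 α, Real.rpow_lt_one hc.1.le hc.2 hα0⟩
    obtain ⟨ρ, hρ, hρ0, hρs⟩ := exists_stable_mixture hα0 hα1 ν hν0
    refine ⟨ρ, hρ, hρ0, fun s hs ↦ ?_⟩
    rw [hρs s hs, hνs _ (Real.rpow_nonneg hs α), Real.mul_rpow hc.1.le hs]
end
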